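/- Let g : (ℂⁿ, 0) → (ℂⁿ, 0) be a germ of a finite holomorphic map. Let X be a germ of an analytic hypersurface through 0 that is singular at 0. Then the germ of the hypersurface g⁻¹(X) is singular at 0. -/

import Mathlib

open Set Filter Topology

noncomputable section

/-- `ℂⁿ`, modeled as the space of functions `Fin n → ℂ`. -/
abbrev Cn (n : ℕ) : Type := Fin n → ℂ

/-- `X` is an analytic hypersurface in the open set `W`, with its reduced structure:
near every point of `W` it is the zero set of a holomorphic function that does not
vanish identically on a connected neighborhood (hence every irreducible component of
`X` has codimension one). -/
def IsHypersurfaceIn {n : ℕ} (W X : Set (Cn n)) : Prop :=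
  X ⊆ W ∧ ∀ p ∈ W, ∃ V : Set (Cn n), IsOpen V ∧ IsPreconnected V ∧ p ∈ V ∧ V ⊆ W ∧
    ∃ ψ : Cn n → ℂ, AnalyticOnNhd ℂ ψ V ∧ (∃ x ∈ V, ψ x ≠ 0) ∧ X ∩ V = {x ∈ V | ψ x = 0}

/-- A hypersurface `X` is smooth at `p` if near `p` it is a codimension-one complex
submanifold of `ℂⁿ`, i.e. the zero set of a holomorphic function submersive at `p`.
"`X` is singular at `p`" is the negation of this. -/
def SmoothPointAt {n : ℕ} (X : Set (Cn n)) (p : Cn n) : Prop :=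
  ∃ (V : Set (Cn n)) (φ : Cn n → ℂ), IsOpen V ∧ p ∈ V ∧ AnalyticOnNhd ℂ φ V ∧
    fderiv ℂ φ p ≠ 0 ∧ X ∩ V = {x ∈ V | φ x = 0}

/-- Bounded functions on the words in the letters `0, …, n - 1`. -/
abbrev Words (n : ℕ) : Type := lp (fun _ : List (Fin n) => ℂ) ⊤

namespace Words

variable {n : ℕ}

/-- A linear map given by an operation on words that does not increase the sup norm. -/
def ofBound (F : (List (Fin n) → ℂ) →ₗ[ℂ] (List (Fin n) → ℂ))
    (hF : ∀ (u : List (Fin n) → ℂ) (C : ℝ), (∀ σ, ‖u σ‖ ≤ C) → ∀ σ, ‖F u σ‖ ≤ C) :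
    Words n →L[ℂ] Words n :=
  LinearMap.mkContinuous
    { toFun := fun u => ⟨F u, memℓp_infty_iff.2 ⟨‖u‖, by
        rintro _ ⟨σ, rfl⟩
        exact hF u ‖u‖ (fun τ => lp.norm_apply_le_norm (by simp) u τ) σ⟩⟩
      map_add' := fun u v => Subtype.ext (F.map_add u v)
      map_smul' := fun c u => Subtype.ext (F.map_smul c u) } 1
    (fun u => by
      rw [one_mul]
      exact lp.norm_le_of_forall_le (norm_nonneg u)
        (fun σ => hF u ‖u‖ (fun τ => lp.norm_apply_le_norm (by simp) u τ) σ))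

theorem norm_ofBound_le (F : (List (Fin n) → ℂ) →ₗ[ℂ] (List (Fin n) → ℂ))
    (hF : ∀ (u : List (Fin n) → ℂ) (C : ℝ), (∀ σ, ‖u σ‖ ≤ C) → ∀ σ, ‖F u σ‖ ≤ C) :
    ‖ofBound F hF‖ ≤ 1 :=
  LinearMap.mkContinuous_norm_le _ zero_le_one _

/-- Strip the first letter `i`. -/
def strip (i : Fin n) : Words n →L[ℂ] Words n :=
  ofBound
    { toFun := fun u σ => u (i :: σ)
      map_add' := fun _ _ => rfl
      map_smul' := fun _ _ => rfl }
    (fun _ _ h σ => h (i :: σ))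

/-- The operation on functions underlying `prepend`. -/
def prependFun (i : Fin n) (u : List (Fin n) → ℂ) : List (Fin n) → ℂ
  | [] => 0
  | j :: σ => if j = i then u σ else 0

/-- Prepend the letter `i`. -/
def prepend (i : Fin n) : Words n →L[ℂ] Words n :=
  ofBound
    { toFun := prependFun i
      map_add' := fun u v => by
        funext σ
        cases σ with
        | nil => simp [prependFun]
        | cons j σ => by_cases h : j = i <;> simp [prependFun, h]
      map_smul' := fun c u => by
        funext σ
        cases σ with
        | nil => simp [prependFun]
        | cons j σ => by_cases h : j = i <;> simp [prependFun, h] }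
    (fun u C h σ => by
      have hC : 0 ≤ C := (norm_nonneg _).trans (h [])
      cases σ with
      | nil => simpa [prependFun] using hC
      | cons j σ =>
        by_cases hj : j = i
        · simpa [prependFun, hj] using h σ
        · simpa [prependFun, hj] using hC)

/-- The indicator of the empty word. -/
def unit : Words n := lp.single ⊤ [] (1 : ℂ)

/-- The value at the empty word. -/
def coord : Words n →L[ℂ] ℂ :=
  LinearMap.mkContinuous
    { toFun := fun u => u []
      map_add' := fun _ _ => rfl
      map_smul' := fun _ _ => rfl } 1
    (fun u => by
      rw [one_mul]
      exact lp.norm_apply_le_norm (by simp) u [])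

theorem strip_apply (i : Fin n) (u : Words n) (σ : List (Fin n)) :
    strip i u σ = u (i :: σ) := rfl

theorem prepend_apply (i : Fin n) (u : Words n) (σ : List (Fin n)) :
    prepend i u σ = prependFun i u σ := rfl

theorem norm_prepend_le (i : Fin n) : ‖prepend i‖ ≤ 1 := norm_ofBound_le _ _

theorem strip_prepend_self (i : Fin n) (u : Words n) : strip i (prepend i u) = u := by
  ext σ
  simp [strip_apply, prepend_apply, prependFun]

theorem strip_prepend_of_ne {i j : Fin n} (h : i ≠ j) (u : Words n) :
    strip i (prepend j u) = 0 := by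
  ext σ
  simp [strip_apply, prepend_apply, prependFun, h]

theorem coord_prepend (i : Fin n) (u : Words n) : coord (prepend i u) = 0 := rfl

theorem strip_unit (i : Fin n) : strip i (unit : Words n) = 0 := by
  ext σ
  simp [strip_apply, unit, lp.single_apply]

theorem coord_unit : coord (unit : Words n) = 1 := by
  change (lp.single ⊤ [] (1 : ℂ) : Words n) [] = 1
  simp

/-- The pencil `1 - ∑ yᵢ ρ⁻¹ stripᵢ`. -/
def pencil (ρ : ℝ) (y : Cn n) : Words n →L[ℂ] Words n :=
  1 - ∑ i, (y i * (ρ : ℂ)⁻¹) • strip i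

/-- Evaluation of a word function, regarded as a noncommutative power series. -/
def ev (ρ : ℝ) (y : Cn n) : Words n →L[ℂ] ℂ := coord ∘L Ring.inverse (pencil ρ y)

theorem analyticAt_pencil (ρ : ℝ) (y : Cn n) : AnalyticAt ℂ (pencil ρ) y := by
  unfold pencil
  refine analyticAt_const.sub ?_
  refine Finset.analyticAt_fun_sum _ fun i _ => ?_
  refine AnalyticAt.smul (f := fun y : Cn n => y i * (ρ : ℂ)⁻¹) (AnalyticAt.mul ?_ analyticAt_const)
    analyticAt_const
  exact (ContinuousLinearMap.proj (R := ℂ) (φ := fun _ : Fin n => ℂ) i).analyticAt y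

theorem pencil_zero (ρ : ℝ) : pencil ρ (0 : Cn n) = 1 := by
  rw [pencil, Finset.sum_eq_zero, sub_zero]
  intro i _
  rw [Pi.zero_apply, zero_mul]
  exact zero_smul ℂ (strip i)

theorem analyticAt_inverse_pencil (ρ : ℝ) :
    AnalyticAt ℂ (fun y : Cn n => Ring.inverse (pencil ρ y)) 0 := by
  have h := analyticAt_inverse (𝕜 := ℂ) (1 : (Words n →L[ℂ] Words n)ˣ)
  refine AnalyticAt.fun_comp (f := pencil ρ) (x := (0 : Cn n)) ?_ (analyticAt_pencil ρ 0)
  rw [pencil_zero]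
  exact h

theorem analyticAt_ev (ρ : ℝ) : AnalyticAt ℂ (ev ρ : Cn n → _) 0 := by
  have h : (ev ρ : Cn n → Words n →L[ℂ] ℂ) =
      fun y => (ContinuousLinearMap.compL ℂ (Words n) (Words n) ℂ coord)
        (Ring.inverse (pencil ρ y)) := rfl
  rw [h]
  exact ((ContinuousLinearMap.compL ℂ (Words n) (Words n) ℂ coord).analyticAt _).fun_comp
    (analyticAt_inverse_pencil ρ)

theorem eventually_isUnit_pencil (ρ : ℝ) : ∀ᶠ y : Cn n in 𝓝 0, IsUnit (pencil ρ y) := by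
  have h : Tendsto (pencil ρ) (𝓝 (0 : Cn n)) (𝓝 1) := by
    have := (analyticAt_pencil ρ (0 : Cn n)).continuousAt.tendsto
    rwa [pencil_zero] at this
  exact h.eventually (Units.nhds (1 : (Words n →L[ℂ] Words n)ˣ))

theorem inverse_pencil_pencil {ρ : ℝ} {y : Cn n} (h : IsUnit (pencil ρ y)) (u : Words n) :
    Ring.inverse (pencil ρ y) (pencil ρ y u) = u := by
  have := Ring.inverse_mul_cancel _ h
  simpa using congrArg (fun T : Words n →L[ℂ] Words n => T u) this

theorem pencil_inverse_pencil {ρ : ℝ} {y : Cn n} (h : IsUnit (pencil ρ y)) (u : Words n) :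
    pencil ρ y (Ring.inverse (pencil ρ y) u) = u := by
  have := Ring.mul_inverse_cancel _ h
  simpa using congrArg (fun T : Words n →L[ℂ] Words n => T u) this

theorem pencil_apply (ρ : ℝ) (y : Cn n) (u : Words n) :
    pencil ρ y u = u - ∑ i, (y i * (ρ : ℂ)⁻¹) • strip i u := by
  simp [pencil]

theorem ev_unit {ρ : ℝ} {y : Cn n} (h : IsUnit (pencil ρ y)) : ev ρ y unit = 1 := by
  have h1 : pencil ρ y unit = unit := by simp [pencil_apply, strip_unit]
  have h2 := inverse_pencil_pencil h unit
  rw [h1] at h2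
  simp [ev, h2, coord_unit]

theorem ev_prepend {ρ : ℝ} (hρ : ρ ≠ 0) {y : Cn n} (h : IsUnit (pencil ρ y)) (j : Fin n)
    (u : Words n) : ev ρ y ((ρ : ℂ) • prepend j u) = y j * ev ρ y u := by
  have hρ' : (ρ : ℂ) ≠ 0 := by exact_mod_cast hρ
  have h1 : pencil ρ y ((ρ : ℂ) • prepend j u) = (ρ : ℂ) • prepend j u - y j • u := by
    rw [pencil_apply, Finset.sum_eq_single j]
    · rw [map_smul, strip_prepend_self, smul_smul, mul_assoc, inv_mul_cancel₀ hρ', mul_one]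
    · intro i _ hi
      rw [map_smul, strip_prepend_of_ne hi, smul_zero, smul_zero]
    · exact fun hj => absurd (Finset.mem_univ j) hj
  have h2 := inverse_pencil_pencil h ((ρ : ℂ) • prepend j u)
  rw [h1, map_sub, map_smul _ (y j) u] at h2
  have h3 := congrArg coord h2
  rw [map_sub, map_smul coord (y j), map_smul coord (ρ : ℂ) (prepend j u), coord_prepend,
    smul_zero, sub_eq_zero] at h3
  exact h3

theorem ev_eq {ρ : ℝ} {y : Cn n} (h : IsUnit (pencil ρ y)) (u : Words n) :
    ev ρ y u = coord u + ∑ i, y i * ev ρ y ((ρ : ℂ)⁻¹ • strip i u) := by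
  have h2 := inverse_pencil_pencil h u
  rw [pencil_apply, map_sub, map_sum] at h2
  have h3 := congrArg coord h2
  rw [map_sub, map_sum, sub_eq_iff_eq_add] at h3
  simp only [ev, ContinuousLinearMap.comp_apply, h3]
  simp [mul_assoc]

/-- Prepend a word. -/
def prependList (σ : List (Fin n)) : Words n →L[ℂ] Words n := (σ.map prepend).prod

theorem norm_prependList_le (σ : List (Fin n)) : ‖prependList σ‖ ≤ 1 := by
  induction σ with
  | nil => exact ContinuousLinearMap.norm_id_le
  | cons i σ ih =>
    have : prependList (i :: σ) = prepend i * prependList σ := by simp [prependList]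
    rw [this]
    exact (norm_mul_le _ _).trans (mul_le_one₀ (norm_prepend_le i) (norm_nonneg _) ih)

theorem ev_prependList {ρ : ℝ} (hρ : ρ ≠ 0) {y : Cn n} (h : IsUnit (pencil ρ y))
    (σ : List (Fin n)) (u : Words n) :
    ev ρ y ((ρ : ℂ) ^ σ.length • prependList σ u) = (σ.map y).prod * ev ρ y u := by
  induction σ with
  | nil => simp [prependList]
  | cons i σ ih =>
    have : prependList (i :: σ) u = prepend i (prependList σ u) := by simp [prependList]
    rw [this, List.length_cons, pow_succ', mul_smul, ← map_smul, ev_prepend hρ h, ih]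
    simp [mul_assoc]

/-- The multiplication operator attached to an analytic function. -/
theorem exists_mul_operator {f : Cn n → ℂ} (hf : AnalyticAt ℂ f 0) :
    ∀ᶠ ρ : ℝ in 𝓝[>] 0, ∃ M : Words n →L[ℂ] Words n,
      ∀ᶠ y in 𝓝 (0 : Cn n), ∀ u, ev ρ y (M u) = f y * ev ρ y u := by
  obtain ⟨p, r, hp⟩ := hf
  obtain ⟨r', hr'0, hr'⟩ := ENNReal.lt_iff_exists_nnreal_btwn.1 hp.r_pos
  have hr0 : (0 : ℝ) < r' := by exact_mod_cast hr'0
  have hsm : Summable fun k => ‖p k‖ * (r' : ℝ) ^ k :=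
    p.summable_norm_mul_pow (hr'.trans_le hp.r_le)
  have hev : ∀ᶠ ρ : ℝ in 𝓝[>] 0, ρ * (n + 1) < r' := by
    have : Tendsto (fun ρ : ℝ => ρ * (n + 1)) (𝓝 0) (𝓝 (0 * ((n : ℝ) + 1))) :=
      (continuous_id.mul continuous_const).tendsto 0
    rw [zero_mul] at this
    exact (this.eventually (gt_mem_nhds hr0)).filter_mono nhdsWithin_le_nhds
  filter_upwards [hev, self_mem_nhdsWithin] with ρ hρ hρ0
  have hρ0 : 0 < ρ := hρ0
  let e : Fin n → Cn n := fun i => Pi.single i 1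
  let T : ℕ → (Words n →L[ℂ] Words n) := fun k =>
    ∑ σ : Fin k → Fin n, p k (fun a => e (σ a)) • ((ρ : ℂ) ^ k • prependList (List.ofFn σ))
  have hT : Summable T := by
    refine Summable.of_norm_bounded hsm fun k => ?_
    calc ‖T k‖ ≤ ∑ σ : Fin k → Fin n, ‖p k‖ * ρ ^ k := by
          refine norm_sum_le_of_le _ fun σ _ => ?_
          rw [norm_smul, norm_smul]
          have h1 : ‖p k (fun a => e (σ a))‖ ≤ ‖p k‖ := by
            refine ((p k).le_opNorm _).trans ?_
            refine mul_le_of_le_one_right (norm_nonneg _) ?_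
            refine Finset.prod_le_one (fun _ _ => norm_nonneg _) fun a _ => ?_
            rw [Pi.norm_single, norm_one]
          have h2 : ‖(ρ : ℂ) ^ k‖ * ‖prependList (List.ofFn σ)‖ ≤ ρ ^ k := by
            rw [norm_pow, Complex.norm_real, Real.norm_of_nonneg hρ0.le]
            exact mul_le_of_le_one_right (by positivity) (norm_prependList_le _)
          exact mul_le_mul h1 h2 (by positivity) (norm_nonneg _)
      _ = ‖p k‖ * (ρ * n) ^ k := by
          simp [Finset.sum_const, mul_pow]
          ring
      _ ≤ ‖p k‖ * (r' : ℝ) ^ k := by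
          gcongr
          nlinarith
  refine ⟨∑' k, T k, ?_⟩
  filter_upwards [eventually_isUnit_pencil ρ, Metric.eball_mem_nhds (0 : Cn n) hp.r_pos]
    with y hy hyr u
  have h1 : HasSum (fun k => ev ρ y (T k u)) (ev ρ y ((∑' k, T k) u)) := by
    have := hT.hasSum.mapL (ContinuousLinearMap.apply ℂ (Words n) u)
    exact this.mapL (ev ρ y)
  have h2 : ∀ k, ev ρ y (T k u) = p k (fun _ => y) * ev ρ y u := by
    intro k
    have hy' : y = ∑ i, y i • e i := by
      simpa [e] using (pi_eq_sum_univ' y)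
    have h3 : p k (fun _ => y) = ∑ σ : Fin k → Fin n, (∏ a, y (σ a)) * p k (fun a => e (σ a)) := by
      conv_lhs => rw [hy']
      rw [(p k).map_sum (fun (_ : Fin k) (i : Fin n) => y i • e i)]
      refine Finset.sum_congr rfl fun σ _ => ?_
      rw [(p k).map_smul_univ (fun a => y (σ a)) (fun a => e (σ a)), smul_eq_mul]
    rw [h3, Finset.sum_mul]
    simp only [T, _root_.sum_apply, map_sum]
    refine Finset.sum_congr rfl fun σ _ => ?_
    have h4 := ev_prependList hρ0.ne' hy (List.ofFn σ) u
    rw [List.length_ofFn, List.map_ofFn, List.prod_ofFn] at h4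
    rw [_root_.smul_apply, _root_.smul_apply, map_smul, h4, smul_eq_mul]
    simp only [Function.comp_apply]
    ring
  simp_rw [h2] at h1
  have h5 := hp.hasSum hyr
  rw [zero_add] at h5
  exact h1.unique (h5.mul_right _)

end Words

/-- The linear projection setting the coordinates in `s` to zero. -/
def zeroOn {n : ℕ} (s : Finset (Fin n)) : Cn n →L[ℂ] Cn n :=
  ContinuousLinearMap.pi fun i => if i ∈ s then 0 else ContinuousLinearMap.proj i

theorem zeroOn_apply {n : ℕ} (s : Finset (Fin n)) (y : Cn n) (i : Fin n) :
    zeroOn s y i = if i ∈ s then 0 else y i := by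
  by_cases h : i ∈ s <;> simp [zeroOn, h]

theorem tendsto_clm_zero {E F : Type*} [NormedAddCommGroup E] [NormedSpace ℂ E]
    [NormedAddCommGroup F] [NormedSpace ℂ F] (T : E →L[ℂ] F) : Tendsto T (𝓝 0) (𝓝 0) := by
  simpa using T.continuous.tendsto 0

theorem AnalyticAt.clm_apply_fun {E F G : Type*} [NormedAddCommGroup E] [NormedSpace ℂ E]
    [NormedAddCommGroup F] [NormedSpace ℂ F] [NormedAddCommGroup G] [NormedSpace ℂ G]
    {f : E → F →L[ℂ] G} {u : E → F} {x : E} (hf : AnalyticAt ℂ f x) (hu : AnalyticAt ℂ u x) :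
    AnalyticAt ℂ (fun y => f y (u y)) x :=
  AnalyticAt.comp₂ ((ContinuousLinearMap.id ℂ (F →L[ℂ] G)).analyticAt_bilinear (f x, u x)) hf hu

/-- Hadamard's lemma for analytic functions. -/
theorem exists_hadamard {n : ℕ} {f : Cn n → ℂ} (hf : AnalyticAt ℂ f 0) (s : Finset (Fin n)) :
    ∃ q : Fin n → Cn n → ℂ, (∀ i, AnalyticAt ℂ (q i) 0) ∧
      ∀ᶠ y in 𝓝 (0 : Cn n), f y - f (zeroOn s y) = ∑ i ∈ s, y i * q i y := by
  obtain ⟨ρ, ⟨M, hM⟩, hρ⟩ := ((Words.exists_mul_operator hf).and self_mem_nhdsWithin).exists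
  have hρ0 : ρ ≠ 0 := ne_of_gt hρ
  have hπ := tendsto_clm_zero (zeroOn s)
  set u := M Words.unit with hu
  refine ⟨fun i y => Words.ev ρ y
    (((ρ : ℂ)⁻¹ • Words.strip i) (Ring.inverse (Words.pencil ρ (zeroOn s y)) u)), fun i => ?_, ?_⟩
  · have h1 : AnalyticAt ℂ (fun y => Ring.inverse (Words.pencil ρ (zeroOn s y)) u) 0 := by
      have h2 : AnalyticAt ℂ (fun y => Ring.inverse (Words.pencil ρ (zeroOn s y))) 0 := by
        refine AnalyticAt.fun_comp (g := fun y => Ring.inverse (Words.pencil ρ y)) ?_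
          ((zeroOn s).analyticAt 0)
        rw [map_zero]
        exact Words.analyticAt_inverse_pencil ρ
      exact AnalyticAt.clm_apply_fun h2 analyticAt_const
    exact AnalyticAt.clm_apply_fun (Words.analyticAt_ev ρ)
      ((((ρ : ℂ)⁻¹ • Words.strip i).analyticAt _).fun_comp h1)
  · filter_upwards [hM, hπ.eventually hM, Words.eventually_isUnit_pencil ρ,
      hπ.eventually (Words.eventually_isUnit_pencil ρ)] with y h1 h2 h3 h4
    have e1 : f y = Words.ev ρ y u := by rw [hu, h1, Words.ev_unit h3, mul_one]
    have e2 : f (zeroOn s y) = Words.ev ρ (zeroOn s y) u := by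
      rw [hu, h2, Words.ev_unit h4, mul_one]
    set v := Ring.inverse (Words.pencil ρ (zeroOn s y)) u with hv
    have e3 : u = Words.pencil ρ (zeroOn s y) v := (Words.pencil_inverse_pencil h4 u).symm
    have e4 : Words.pencil ρ (zeroOn s y) v - Words.pencil ρ y v =
        ∑ i ∈ s, y i • ((ρ : ℂ)⁻¹ • Words.strip i v) := by
      rw [Words.pencil_apply, Words.pencil_apply, sub_sub_sub_cancel_left,
        ← Finset.sum_sub_distrib, ← Finset.sum_subset (Finset.subset_univ s)]
      · refine Finset.sum_congr rfl fun i hi => ?_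
        rw [zeroOn_apply, if_pos hi, zero_mul, zero_smul ℂ (Words.strip i v), sub_zero, mul_smul]
      · intro i _ hi
        rw [zeroOn_apply, if_neg hi, sub_self]
    have e5 := congrArg (Words.ev ρ y) e4
    rw [map_sub, ← e3, map_sum] at e5
    have e6 : Words.ev ρ y (Words.pencil ρ y v) = Words.ev ρ (zeroOn s y) u := by
      change Words.coord (Ring.inverse (Words.pencil ρ y) (Words.pencil ρ y v)) = Words.coord v
      rw [Words.inverse_pencil_pencil h3]
    rw [e6, ← e1, ← e2] at e5
    rw [e5]
    refine Finset.sum_congr rfl fun i _ => ?_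
    rw [map_smul _ (y i), smul_eq_mul]
    rfl

/-- The algebra of functions analytic at `0`. -/
def analyticFunctions (n : ℕ) : Subalgebra ℂ (Cn n → ℂ) where
  carrier := {f | AnalyticAt ℂ f 0}
  mul_mem' := fun hf hg => hf.mul hg
  add_mem' := fun hf hg => hf.add hg
  algebraMap_mem' := fun _ => analyticAt_const

/-- The ideal of analytic functions vanishing near `0`. -/
def vanishingIdeal (n : ℕ) : Ideal (analyticFunctions n) where
  carrier := {f | ∀ᶠ y in 𝓝 0, (f : Cn n → ℂ) y = 0}
  add_mem' := fun {f g} hf hg => by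
    filter_upwards [hf, hg] with y h1 h2
    simp [h1, h2]
  zero_mem' := Eventually.of_forall fun _ => rfl
  smul_mem' := fun c f hf => by
    filter_upwards [hf] with y h1
    simp [h1]

/-- The ring of germs at `0` of analytic functions on `ℂⁿ`. -/
def GermRing (n : ℕ) : Type := analyticFunctions n ⧸ vanishingIdeal n

namespace GermRing

instance (n : ℕ) : CommRing (GermRing n) :=
  inferInstanceAs (CommRing (analyticFunctions n ⧸ vanishingIdeal n))

instance (n : ℕ) : Algebra ℂ (GermRing n) :=
  inferInstanceAs (Algebra ℂ (analyticFunctions n ⧸ vanishingIdeal n))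

variable {n m : ℕ}

/-- The germ of an analytic function. -/
def mk (f : Cn n → ℂ) (hf : AnalyticAt ℂ f 0) : GermRing n :=
  Ideal.Quotient.mk (vanishingIdeal n) ⟨f, hf⟩

theorem mk_eq_mk {f g : Cn n → ℂ} {hf : AnalyticAt ℂ f 0} {hg : AnalyticAt ℂ g 0} :
    mk f hf = mk g hg ↔ f =ᶠ[𝓝 0] g := by
  refine Ideal.Quotient.eq.trans ?_
  change (∀ᶠ y in 𝓝 0, f y - g y = 0) ↔ _
  exact eventually_congr (Eventually.of_forall fun y => sub_eq_zero)

theorem exists_rep (φ : GermRing n) : ∃ (f : Cn n → ℂ) (hf : AnalyticAt ℂ f 0), mk f hf = φ := by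
  obtain ⟨⟨f, hf⟩, h⟩ := Ideal.Quotient.mk_surjective (I := vanishingIdeal n) φ
  exact ⟨f, hf, h⟩

/-- A representative of a germ. -/
def rep (φ : GermRing n) : Cn n → ℂ := (exists_rep φ).choose

theorem analyticAt_rep (φ : GermRing n) : AnalyticAt ℂ (rep φ) 0 := (exists_rep φ).choose_spec.choose

@[simp] theorem mk_rep (φ : GermRing n) : mk (rep φ) (analyticAt_rep φ) = φ :=
  (exists_rep φ).choose_spec.choose_spec

theorem rep_mk {f : Cn n → ℂ} (hf : AnalyticAt ℂ f 0) : rep (mk f hf) =ᶠ[𝓝 0] f :=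
  mk_eq_mk.1 (mk_rep (mk f hf))

theorem eq_iff {φ ψ : GermRing n} : φ = ψ ↔ rep φ =ᶠ[𝓝 0] rep ψ := by
  rw [← mk_eq_mk (hf := analyticAt_rep φ) (hg := analyticAt_rep ψ), mk_rep, mk_rep]

theorem eq_mk_iff {φ : GermRing n} {f : Cn n → ℂ} {hf : AnalyticAt ℂ f 0} :
    φ = mk f hf ↔ rep φ =ᶠ[𝓝 0] f := by
  rw [← mk_eq_mk (hf := analyticAt_rep φ) (hg := hf), mk_rep]

theorem rep_add (φ ψ : GermRing n) : rep (φ + ψ) =ᶠ[𝓝 0] fun y => rep φ y + rep ψ y := by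
  rw [← eq_mk_iff (hf := (analyticAt_rep φ).fun_add (analyticAt_rep ψ))]
  conv_lhs => rw [← mk_rep φ, ← mk_rep ψ]
  rfl

theorem rep_mul (φ ψ : GermRing n) : rep (φ * ψ) =ᶠ[𝓝 0] fun y => rep φ y * rep ψ y := by
  rw [← eq_mk_iff (hf := (analyticAt_rep φ).fun_mul (analyticAt_rep ψ))]
  conv_lhs => rw [← mk_rep φ, ← mk_rep ψ]
  rfl

theorem rep_algebraMap (c : ℂ) : rep (algebraMap ℂ (GermRing n) c) =ᶠ[𝓝 0] fun _ => c := by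
  rw [← eq_mk_iff (hf := analyticAt_const)]
  rfl

theorem rep_smul (c : ℂ) (φ : GermRing n) : rep (c • φ) =ᶠ[𝓝 0] fun y => c * rep φ y := by
  rw [Algebra.smul_def]
  filter_upwards [rep_mul (algebraMap ℂ _ c) φ, rep_algebraMap (n := n) c] with y h1 h2
  rw [h1, h2]

theorem rep_zero : rep (0 : GermRing n) =ᶠ[𝓝 0] fun _ => 0 := by
  simpa using rep_algebraMap (n := n) 0

theorem rep_one : rep (1 : GermRing n) =ᶠ[𝓝 0] fun _ => 1 := by
  simpa using rep_algebraMap (n := n) 1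

theorem rep_sum {ι : Type*} (s : Finset ι) (φ : ι → GermRing n) :
    rep (∑ i ∈ s, φ i) =ᶠ[𝓝 0] fun y => ∑ i ∈ s, rep (φ i) y := by
  classical
  induction s using Finset.induction_on with
  | empty => simpa using rep_zero
  | insert a s ha ih =>
    rw [Finset.sum_insert ha]
    filter_upwards [rep_add (φ a) (∑ i ∈ s, φ i), ih] with y h1 h2
    rw [h1, h2, Finset.sum_insert ha]

theorem rep_pow (φ : GermRing n) (k : ℕ) : rep (φ ^ k) =ᶠ[𝓝 0] fun y => rep φ y ^ k := by
  induction k with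
  | zero => simpa using rep_one
  | succ k ih =>
    rw [pow_succ]
    filter_upwards [rep_mul (φ ^ k) φ, ih] with y h1 h2
    rw [h1, h2, pow_succ]

theorem eq_zero_iff {φ : GermRing n} : φ = 0 ↔ ∀ᶠ y in 𝓝 0, rep φ y = 0 :=
  eq_iff.trans ⟨fun h => h.trans rep_zero, fun h => EventuallyEq.trans h rep_zero.symm⟩

/-- The value of a germ at the origin. -/
def value (n : ℕ) : GermRing n →ₐ[ℂ] ℂ where
  toFun φ := rep φ 0
  map_one' := rep_one.eq_of_nhds
  map_mul' φ ψ := (rep_mul φ ψ).eq_of_nhds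
  map_zero' := rep_zero.eq_of_nhds
  map_add' φ ψ := (rep_add φ ψ).eq_of_nhds
  commutes' c := (rep_algebraMap c).eq_of_nhds

theorem value_apply (φ : GermRing n) : value n φ = rep φ 0 := rfl

theorem value_mk {f : Cn n → ℂ} (hf : AnalyticAt ℂ f 0) : value n (mk f hf) = f 0 :=
  (rep_mk hf).eq_of_nhds

theorem isUnit_iff {φ : GermRing n} : IsUnit φ ↔ value n φ ≠ 0 := by
  constructor
  · exact fun h => (h.map (value n)).ne_zero
  · intro h
    refine IsUnit.of_mul_eq_one (mk (fun y => (rep φ y)⁻¹) ((analyticAt_rep φ).fun_inv h)) ?_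
    rw [eq_iff]
    filter_upwards [rep_mul φ (mk _ ((analyticAt_rep φ).fun_inv h)), rep_one (n := n),
      rep_mk ((analyticAt_rep φ).fun_inv h),
      (analyticAt_rep φ).continuousAt.eventually_ne h] with y h1 h2 h3 h4
    rw [h1, h2, h3]
    exact mul_inv_cancel₀ h4

instance : Nontrivial (GermRing n) := (value n).toRingHom.domain_nontrivial

instance : IsLocalRing (GermRing n) :=
  IsLocalRing.of_nonunits_add fun a b ha hb => by
    simp only [mem_nonunits_iff, isUnit_iff, not_not] at *
    rw [map_add, ha, hb, add_zero]

theorem mem_maximalIdeal {φ : GermRing n} :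
    φ ∈ IsLocalRing.maximalIdeal (GermRing n) ↔ value n φ = 0 := by
  rw [IsLocalRing.mem_maximalIdeal, mem_nonunits_iff, isUnit_iff, not_not]

theorem analyticAt_comp_rep {g : Cn n → Cn m} (hg : AnalyticAt ℂ g 0) (hg0 : g 0 = 0)
    (φ : GermRing m) : AnalyticAt ℂ (fun y => rep φ (g y)) 0 :=
  AnalyticAt.fun_comp (g := rep φ) (by rw [hg0]; exact analyticAt_rep φ) hg

theorem tendsto_zero {g : Cn n → Cn m} (hg : AnalyticAt ℂ g 0) (hg0 : g 0 = 0) :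
    Tendsto g (𝓝 0) (𝓝 0) := by
  simpa only [hg0] using hg.continuousAt.tendsto

/-- Pullback of germs. -/
def pull (g : Cn n → Cn m) (hg : AnalyticAt ℂ g 0) (hg0 : g 0 = 0) :
    GermRing m →ₐ[ℂ] GermRing n where
  toFun φ := mk (fun y => rep φ (g y)) (analyticAt_comp_rep hg hg0 φ)
  map_one' := by
    symm
    exact eq_mk_iff.2 (rep_one.trans (EventuallyEq.symm ((tendsto_zero hg hg0).eventually rep_one)))
  map_mul' φ ψ := by
    rw [eq_comm, eq_mk_iff]
    filter_upwards [(tendsto_zero hg hg0).eventually (rep_mul φ ψ),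
      rep_mul (mk _ (analyticAt_comp_rep hg hg0 φ)) (mk _ (analyticAt_comp_rep hg hg0 ψ)),
      rep_mk (analyticAt_comp_rep hg hg0 φ), rep_mk (analyticAt_comp_rep hg hg0 ψ)]
      with y h1 h2 h3 h4
    rw [h1, h2, h3, h4]
  map_zero' := by
    symm
    exact eq_mk_iff.2 (rep_zero.trans (EventuallyEq.symm ((tendsto_zero hg hg0).eventually rep_zero)))
  map_add' φ ψ := by
    rw [eq_comm, eq_mk_iff]
    filter_upwards [(tendsto_zero hg hg0).eventually (rep_add φ ψ),
      rep_add (mk _ (analyticAt_comp_rep hg hg0 φ)) (mk _ (analyticAt_comp_rep hg hg0 ψ)),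
      rep_mk (analyticAt_comp_rep hg hg0 φ), rep_mk (analyticAt_comp_rep hg hg0 ψ)]
      with y h1 h2 h3 h4
    rw [h1, h2, h3, h4]
  commutes' c := by
    symm
    exact eq_mk_iff.2 ((rep_algebraMap c).trans
      (EventuallyEq.symm ((tendsto_zero hg hg0).eventually (rep_algebraMap c))))

theorem rep_pull {g : Cn n → Cn m} (hg : AnalyticAt ℂ g 0) (hg0 : g 0 = 0) (φ : GermRing m) :
    rep (pull g hg hg0 φ) =ᶠ[𝓝 0] fun y => rep φ (g y) :=
  rep_mk (analyticAt_comp_rep hg hg0 φ)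

theorem value_pull {g : Cn n → Cn m} (hg : AnalyticAt ℂ g 0) (hg0 : g 0 = 0) (φ : GermRing m) :
    value n (pull g hg hg0 φ) = value m φ := by
  rw [value_apply, (rep_pull hg hg0 φ).eq_of_nhds, hg0, value_apply]

theorem analyticAt_coord (i : Fin n) (x : Cn n) : AnalyticAt ℂ (fun y : Cn n => y i) x :=
  (ContinuousLinearMap.proj (R := ℂ) (φ := fun _ : Fin n => ℂ) i).analyticAt x

/-- The coordinate germs. -/
def X (i : Fin n) : GermRing n := mk (fun y => y i) (analyticAt_coord i 0)

theorem rep_X (i : Fin n) : rep (X i) =ᶠ[𝓝 0] fun y => y i := rep_mk _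

/-- A germ lies in the ideal of some of the coordinates iff it vanishes on the corresponding
coordinate subspace. -/
theorem mem_span_X_iff (s : Finset (Fin n)) (φ : GermRing n) :
    φ ∈ Ideal.span (X '' (s : Set (Fin n))) ↔ ∀ᶠ y in 𝓝 0, rep φ (zeroOn s y) = 0 := by
  have hπ := tendsto_clm_zero (zeroOn s)
  constructor
  · intro h
    induction h using Submodule.span_induction with
    | mem x hx =>
      obtain ⟨i, hi, rfl⟩ := hx
      filter_upwards [hπ.eventually (rep_X i)] with y hy
      rw [hy, zeroOn_apply, if_pos (Finset.mem_coe.1 hi)]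
    | zero => exact hπ.eventually rep_zero
    | add a b _ _ ha hb =>
      filter_upwards [ha, hb, hπ.eventually (rep_add a b)] with y h1 h2 h3
      rw [h3, h1, h2, add_zero]
    | smul a b _ hb =>
      filter_upwards [hb, hπ.eventually (rep_mul a b)] with y h2 h3
      rw [smul_eq_mul, h3, h2, mul_zero]
  · intro h
    obtain ⟨q, hq, hqe⟩ := exists_hadamard (analyticAt_rep φ) s
    have : φ = ∑ i ∈ s, X i * mk (q i) (hq i) := by
      rw [eq_iff]
      have h2 : ∀ᶠ y in 𝓝 0, ∀ i, rep (X i * mk (q i) (hq i)) y = y i * q i y := by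
        rw [eventually_all]
        intro i
        filter_upwards [rep_mul (X i) (mk (q i) (hq i)), rep_X i, rep_mk (hq i)] with y h1 h2 h3
        rw [h1, h2, h3]
      filter_upwards [h, hqe, rep_sum s fun i => X i * mk (q i) (hq i), h2] with y h3 h4 h5 h6
      rw [h5, Finset.sum_congr rfl fun i _ => h6 i, ← h4, h3, sub_zero]
    rw [this]
    exact sum_mem fun i hi => Ideal.mul_mem_right _ _ (Ideal.subset_span ⟨i, hi, rfl⟩)

theorem maximalIdeal_eq_span : IsLocalRing.maximalIdeal (GermRing n) = Ideal.span (range X) := by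
  ext φ
  have h := mem_span_X_iff Finset.univ φ
  rw [Finset.coe_univ, image_univ] at h
  rw [h, mem_maximalIdeal, value_apply]
  have h0 : ∀ y : Cn n, zeroOn Finset.univ y = 0 := fun y => by
    funext i
    simp [zeroOn_apply]
  simp [h0]

theorem X_mem_maximalIdeal (i : Fin n) : X i ∈ IsLocalRing.maximalIdeal (GermRing n) := by
  rw [maximalIdeal_eq_span]
  exact Ideal.subset_span ⟨i, rfl⟩

end GermRing

section OperatorPencil

variable {E : Type*} [NormedAddCommGroup E] [NormedSpace ℂ E] {m : ℕ}

/-- The pencil `1 - ∑ zᵢ Nᵢ` of operators. -/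
def opPencil (N : Fin m → E →L[ℂ] E) (z : Cn m) : E →L[ℂ] E := 1 - ∑ i, z i • N i

theorem analyticAt_opPencil (N : Fin m → E →L[ℂ] E) : AnalyticAt ℂ (opPencil N) 0 := by
  refine analyticAt_const.sub (Finset.analyticAt_fun_sum _ fun i _ => ?_)
  exact AnalyticAt.smul (f := fun y : Cn m => y i) (GermRing.analyticAt_coord i 0) analyticAt_const

theorem opPencil_zero (N : Fin m → E →L[ℂ] E) : opPencil N 0 = 1 := by
  rw [opPencil, Finset.sum_eq_zero, sub_zero]
  intro i _
  rw [Pi.zero_apply]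
  exact zero_smul ℂ (N i)

theorem inverse_opPencil_apply_eq {N : Fin m → E →L[ℂ] E} {z : Cn m} (h : IsUnit (opPencil N z))
    (u : E) : Ring.inverse (opPencil N z) u =
      u + ∑ i, z i • N i (Ring.inverse (opPencil N z) u) := by
  have h1 : opPencil N z (Ring.inverse (opPencil N z) u) = u :=
    congrArg (fun T : E →L[ℂ] E => T u) (Ring.mul_inverse_cancel _ h)
  rw [← sub_eq_iff_eq_add]
  conv_rhs => rw [← h1]
  simp [opPencil]

variable [CompleteSpace E]

theorem analyticAt_inverse_opPencil (N : Fin m → E →L[ℂ] E) :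
    AnalyticAt ℂ (fun z => Ring.inverse (opPencil N z)) 0 := by
  refine AnalyticAt.fun_comp (f := opPencil N) (x := (0 : Cn m)) ?_ (analyticAt_opPencil N)
  rw [opPencil_zero]
  exact analyticAt_inverse (𝕜 := ℂ) (1 : (E →L[ℂ] E)ˣ)

theorem eventually_isUnit_opPencil (N : Fin m → E →L[ℂ] E) :
    ∀ᶠ z in 𝓝 0, IsUnit (opPencil N z) := by
  have h : Tendsto (opPencil N) (𝓝 0) (𝓝 1) := by
    simpa only [opPencil_zero] using (analyticAt_opPencil N).continuousAt.tendsto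
  exact h.eventually (Units.nhds (1 : (E →L[ℂ] E)ˣ))

end OperatorPencil

namespace GermRing

variable {n m : ℕ}

/-- Expansion of `ev` up to order `K`, with a remainder in the `K`-th power of the
maximal ideal. -/
theorem exists_expansion (n K : ℕ) : ∃ (J J' : Type) (_ : Fintype J) (_ : Fintype J')
    (e : J → GermRing n) (p : J' → GermRing n),
    (∀ j, p j ∈ IsLocalRing.maximalIdeal (GermRing n) ^ K) ∧
    ∀ ρ : ℝ, ∃ (Q : J → Words n →L[ℂ] ℂ) (N : J' → Words n →L[ℂ] Words n),
      ∀ᶠ y in 𝓝 0, ∀ u, Words.ev ρ y u =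
        ∑ j, Q j u * rep (e j) y + ∑ j, rep (p j) y * Words.ev ρ y (N j u) := by
  induction K with
  | zero =>
    refine ⟨Empty, Unit, inferInstance, inferInstance, Empty.elim, fun _ => 1, by simp,
      fun ρ => ⟨Empty.elim, fun _ => ContinuousLinearMap.id ℂ _, ?_⟩⟩
    filter_upwards [rep_one (n := n)] with y hy u
    simp [hy]
  | succ K ih =>
    obtain ⟨J, J', _, _, e, p, hp, h⟩ := ih
    refine ⟨J ⊕ J', J' × Fin n, inferInstance, inferInstance, Sum.elim e p,
      fun a => p a.1 * X a.2, fun a => ?_, fun ρ => ?_⟩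
    · rw [pow_succ]
      exact Ideal.mul_mem_mul (hp a.1) (X_mem_maximalIdeal a.2)
    · obtain ⟨Q, N, hQ⟩ := h ρ
      refine ⟨Sum.elim Q fun j => Words.coord ∘L N j,
        fun a => ((ρ : ℂ)⁻¹ • Words.strip a.2) ∘L N a.1, ?_⟩
      have h1 : ∀ᶠ y in 𝓝 0, ∀ a : J' × Fin n, rep (p a.1 * X a.2) y = rep (p a.1) y * y a.2 := by
        rw [eventually_all]
        intro a
        filter_upwards [rep_mul (p a.1) (X a.2), rep_X a.2] with y h1 h2
        rw [h1, h2]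
      filter_upwards [hQ, h1, Words.eventually_isUnit_pencil ρ] with y h2 h3 h4 u
      rw [h2, Fintype.sum_sum_type, Fintype.sum_prod_type, add_assoc]
      simp only [Sum.elim_inl, Sum.elim_inr]
      congr 1
      rw [← Finset.sum_add_distrib]
      refine Finset.sum_congr rfl fun j _ => ?_
      rw [Words.ev_eq h4 (N j u), mul_add, Finset.mul_sum]
      congr 1
      · exact mul_comm _ _
      · refine Finset.sum_congr rfl fun i _ => ?_
        rw [h3 (j, i), mul_assoc]
        rfl

/-- A map germ whose components generate an ideal containing a power of the maximal ideal
is finite. -/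
theorem exists_generators_pull {g : Cn n → Cn m} (hg : AnalyticAt ℂ g 0) (hg0 : g 0 = 0) {K : ℕ}
    (hK : IsLocalRing.maximalIdeal (GermRing n) ^ K ≤
      Ideal.span (range fun i => pull g hg hg0 (X i))) :
    ∃ (J : Type) (_ : Fintype J) (e : J → GermRing n), ∀ φ : GermRing n,
      ∃ a : J → GermRing m, φ = ∑ j, pull g hg hg0 (a j) * e j := by
  obtain ⟨J, J', _, _, e, p, hp, h⟩ := exists_expansion n K
  refine ⟨J, inferInstance, e, fun φ => ?_⟩
  have hb : ∀ j, ∃ b : Fin m → GermRing n, ∑ i, b i * pull g hg hg0 (X i) = p j := fun j =>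
    Ideal.mem_span_range_iff_exists_fun.1 (hK (hp j))
  choose b hb using hb
  have hops := (eventually_all.2 fun j : J' => eventually_all.2 fun i : Fin m =>
    Words.exists_mul_operator (analyticAt_rep (b j i))).and
      (Words.exists_mul_operator (analyticAt_rep φ))
  obtain ⟨ρ, hM, M₀, hM₀⟩ := hops.exists
  choose M hM using hM
  obtain ⟨Q, N, hQN⟩ := h ρ
  let T : Fin m → Words n →L[ℂ] Words n := fun i => ∑ j, M j i ∘L N j
  have ha : ∀ j, AnalyticAt ℂ
      (fun z => Q j (Ring.inverse (opPencil T z) (M₀ Words.unit))) 0 := fun j =>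
    ((Q j).analyticAt _).fun_comp
      (AnalyticAt.clm_apply_fun (analyticAt_inverse_opPencil T) analyticAt_const)
  have hlim := tendsto_zero hg hg0
  refine ⟨fun j => mk _ (ha j), ?_⟩
  have h1 : ∀ᶠ y in 𝓝 0, ∀ j, rep (pull g hg hg0 (mk _ (ha j)) * e j) y =
      Q j (Ring.inverse (opPencil T (g y)) (M₀ Words.unit)) * rep (e j) y := by
    rw [eventually_all]
    intro j
    filter_upwards [rep_mul (pull g hg hg0 (mk _ (ha j))) (e j), rep_pull hg hg0 (mk _ (ha j)),
      hlim.eventually (rep_mk (ha j))] with y h1 h2 h3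
    rw [h1, h2, h3]
  have h2 : ∀ᶠ y in 𝓝 0, ∀ j, rep (p j) y = ∑ i, rep (b j i) y * g y i := by
    rw [eventually_all]
    intro j
    have h3 : ∀ᶠ y in 𝓝 0, ∀ i, rep (b j i * pull g hg hg0 (X i)) y = rep (b j i) y * g y i := by
      rw [eventually_all]
      intro i
      filter_upwards [rep_mul (b j i) (pull g hg hg0 (X i)), rep_pull hg hg0 (X i),
        hlim.eventually (rep_X i)] with y h1 h2 h3
      rw [h1, h2, h3]
    filter_upwards [rep_sum Finset.univ fun i => b j i * pull g hg hg0 (X i), h3] with y h4 h5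
    rw [← hb, h4, Finset.sum_congr rfl fun i _ => h5 i]
  rw [eq_iff]
  filter_upwards [rep_sum Finset.univ fun j => pull g hg hg0 (mk _ (ha j)) * e j, h1, h2,
    hlim.eventually (eventually_isUnit_opPencil T), hM₀, hQN, Words.eventually_isUnit_pencil ρ,
    eventually_all.2 fun j => eventually_all.2 fun i => hM j i] with y h3 h4 h5 h6 h7 h8 h9 h10
  rw [h3, Finset.sum_congr rfl fun j _ => h4 j]
  set u := Ring.inverse (opPencil T (g y)) (M₀ Words.unit) with hu
  have h11 : u = M₀ Words.unit + ∑ i, g y i • T i u := inverse_opPencil_apply_eq h6 _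
  have h12 := congrArg (Words.ev ρ y) h11
  rw [map_add, h7, Words.ev_unit h9, mul_one, map_sum, h8 u] at h12
  have h13 : ∑ i, Words.ev ρ y (g y i • T i u) = ∑ j, rep (p j) y * Words.ev ρ y (N j u) := by
    simp_rw [h5, Finset.sum_mul]
    rw [Finset.sum_comm]
    refine Finset.sum_congr rfl fun i _ => ?_
    have : T i u = ∑ j, M j i (N j u) := by simp [T]
    rw [map_smul _ (g y i), this, map_sum, smul_eq_mul, Finset.mul_sum]
    refine Finset.sum_congr rfl fun j _ => ?_
    rw [h10]
    ring
  rw [h13] at h12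
  exact (add_right_cancel h12).symm

theorem finite_pull {g : Cn n → Cn m} (hg : AnalyticAt ℂ g 0) (hg0 : g 0 = 0) {K : ℕ}
    (hK : IsLocalRing.maximalIdeal (GermRing n) ^ K ≤
      Ideal.span (range fun i => pull g hg hg0 (X i))) :
    (pull g hg hg0 : GermRing m →+* GermRing n).Finite := by
  obtain ⟨J, _, e, he⟩ := exists_generators_pull hg hg0 hK
  let := (pull g hg hg0 : GermRing m →+* GermRing n).toAlgebra
  change Module.Finite (GermRing m) (GermRing n)
  refine Module.Finite.of_surjective (Fintype.linearCombination (GermRing m) e) fun φ => ?_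
  obtain ⟨a, ha⟩ := he φ
  refine ⟨a, ?_⟩
  rw [Fintype.linearCombination_apply, ha]
  rfl

end GermRing

/-- Near the origin, an analytic function that vanishes on all germs of lines through the
origin vanishes. -/
theorem AnalyticAt.eventually_eq_zero_of_lines {n : ℕ} {f : Cn n → ℂ} (hf : AnalyticAt ℂ f 0)
    (h : ∀ v, ∀ᶠ t : ℂ in 𝓝 0, f (t • v) = 0) : ∀ᶠ y in 𝓝 0, f y = 0 := by
  obtain ⟨r, hr, hball⟩ := Metric.eventually_nhds_iff_ball.1 hf.eventually_analyticAt
  filter_upwards [Metric.ball_mem_nhds (0 : Cn n) hr] with v hv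
  let T : ℂ →L[ℂ] Cn n := (ContinuousLinearMap.id ℂ ℂ).smulRight v
  have hT : ∀ t, T t = t • v := fun t => by simp [T]
  have hU : IsPreconnected (T ⁻¹' Metric.ball 0 r) := by
    have h1 : Convex ℝ (Metric.ball (0 : Cn n) r) := convex_ball _ _
    exact (h1.linear_preimage (T.restrictScalars ℝ : ℂ →ₗ[ℝ] Cn n)).isPreconnected
  have hfT : AnalyticOnNhd ℂ (fun t => f (T t)) (T ⁻¹' Metric.ball 0 r) := fun t ht =>
    (hball _ ht).fun_comp (T.analyticAt t)
  have h0 : (0 : ℂ) ∈ T ⁻¹' Metric.ball 0 r := by simpa using hr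
  have h1 : (1 : ℂ) ∈ T ⁻¹' Metric.ball 0 r := by
    change T 1 ∈ Metric.ball 0 r
    rwa [hT, one_smul]
  have h2 := hfT.eqOn_zero_of_preconnected_of_eventuallyEq_zero hU h0 (by
    filter_upwards [h v] with t ht
    rw [hT, ht, Pi.zero_apply]) h1
  simpa [hT] using h2

theorem AnalyticAt.eventually_eq_zero_or_of_mul {n : ℕ} {f g : Cn n → ℂ} (hf : AnalyticAt ℂ f 0)
    (hg : AnalyticAt ℂ g 0) (h : ∀ᶠ y in 𝓝 0, f y * g y = 0) :
    (∀ᶠ y in 𝓝 0, f y = 0) ∨ ∀ᶠ y in 𝓝 0, g y = 0 := by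
  obtain ⟨r, hr, hball⟩ := Metric.eventually_nhds_iff_ball.1
    (hf.eventually_analyticAt.and (hg.eventually_analyticAt.and h))
  by_contra! hcon
  obtain ⟨hcf, hcg⟩ := hcon
  obtain ⟨v, hvr, hv⟩ := (hcf.and_eventually
    (Metric.ball_mem_nhds (0 : Cn n) hr)).exists.imp fun _ => And.symm
  obtain ⟨w, hwr, hw⟩ := (hcg.and_eventually
    (Metric.ball_mem_nhds (0 : Cn n) hr)).exists.imp fun _ => And.symm
  let T : ℂ → Cn n := fun t => v + t • (w - v)
  have hT : ∀ t, AnalyticAt ℂ T t := fun t =>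
    analyticAt_const.add (((ContinuousLinearMap.id ℂ ℂ).smulRight (w - v)).analyticAt t)
  have hU : IsPreconnected (T ⁻¹' Metric.ball 0 r) := by
    have h1 : Convex ℝ (Metric.ball (0 : Cn n) r) := convex_ball _ _
    refine Convex.isPreconnected ?_
    intro a ha b hb s t hs ht hst
    have : T (s • a + t • b) = s • T a + t • T b := by
      simp only [T]
      have hst' : (s : ℂ) + t = 1 := by exact_mod_cast hst
      ext i
      simp only [Pi.add_apply, Pi.smul_apply, smul_eq_mul, Complex.real_smul, Pi.sub_apply]
      linear_combination -(v i) * hst'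
    change T _ ∈ Metric.ball 0 r
    rw [this]
    exact h1 ha hb hs ht hst
  have key := AnalyticOnNhd.eq_zero_or_eq_zero_of_mul_eq_zero (U := T ⁻¹' Metric.ball 0 r)
    (f := fun t => f (T t)) (g := fun t => g (T t))
    (fun t ht => (hball _ ht).1.fun_comp (hT t)) (fun t ht => (hball _ ht).2.1.fun_comp (hT t))
    (fun t ht => (hball _ ht).2.2) hU
  have h0 : T 0 = v := by simp [T]
  have h1 : T 1 = w := by simp [T]
  rcases key with h2 | h2
  · apply hv
    have := h2 0 (by change T 0 ∈ Metric.ball 0 r; rwa [h0])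
    rwa [h0] at this
  · apply hw
    have := h2 1 (by change T 1 ∈ Metric.ball 0 r; rwa [h1])
    rwa [h1] at this

namespace GermRing

variable {n m : ℕ}

instance : IsDomain (GermRing n) := by
  have : NoZeroDivisors (GermRing n) := ⟨fun {a b} h => by
    simp only [eq_zero_iff] at *
    refine (analyticAt_rep a).eventually_eq_zero_or_of_mul (analyticAt_rep b) ?_
    filter_upwards [h, rep_mul a b] with y h1 h2
    rw [← h2, h1]⟩
  exact NoZeroDivisors.to_isDomain _

theorem X_mul_mem_span_X {s : Finset (Fin n)} {j : Fin n} (hj : j ∉ s) {φ : GermRing n}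
    (h : X j * φ ∈ Ideal.span (X '' (s : Set (Fin n)))) :
    φ ∈ Ideal.span (X '' (s : Set (Fin n))) := by
  rw [mem_span_X_iff] at *
  have hπ := tendsto_clm_zero (zeroOn s)
  have hφ : AnalyticAt ℂ (fun y => rep φ (zeroOn s y)) 0 :=
    AnalyticAt.fun_comp (g := rep φ) (by rw [map_zero]; exact analyticAt_rep φ)
      ((zeroOn s).analyticAt 0)
  have h1 : ∀ᶠ y in 𝓝 0, y j * rep φ (zeroOn s y) = 0 := by
    filter_upwards [h, hπ.eventually (rep_mul (X j) φ), hπ.eventually (rep_X j)] with y h1 h2 h3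
    rw [← h1, h2, h3, zeroOn_apply, if_neg hj]
  refine ((analyticAt_coord j 0).eventually_eq_zero_or_of_mul hφ h1).resolve_left fun h2 => ?_
  have h3 : Tendsto (fun t : ℂ => (Pi.single j t : Cn n)) (𝓝[≠] 0) (𝓝 0) := by
    have := (continuous_single (A := fun _ : Fin n => ℂ) j).tendsto 0
    rw [Pi.single_zero] at this
    exact this.mono_left nhdsWithin_le_nhds
  obtain ⟨t, ht1, ht2⟩ := ((h3.eventually h2).and self_mem_nhdsWithin).exists
  simp at ht1
  exact ht2 ht1

theorem X_ne_zero (j : Fin n) : (X j : GermRing n) ≠ 0 := by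
  intro h
  have := X_mul_mem_span_X (s := ∅) (j := j) (by simp) (φ := 1) (by simp [h])
  simp at this

theorem tendsto_line (v : Cn n) : Tendsto (fun t : ℂ => t • v) (𝓝 0) (𝓝 0) := by
  have h : Continuous fun t : ℂ => t • v := by fun_prop
  simpa using h.tendsto 0

theorem analyticAt_line (φ : GermRing n) (v : Cn n) :
    AnalyticAt ℂ (fun t : ℂ => rep φ (t • v)) 0 :=
  AnalyticAt.fun_comp (g := rep φ) (f := fun t : ℂ => t • v)
    (by rw [zero_smul]; exact analyticAt_rep φ)
    (((ContinuousLinearMap.id ℂ ℂ).smulRight v).analyticAt 0)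

/-- The order of vanishing of a germ along a line. -/
def lineOrder (v : Cn n) (φ : GermRing n) : ℕ∞ := analyticOrderAt (fun t : ℂ => rep φ (t • v)) 0

theorem lineOrder_eq {v : Cn n} {φ : GermRing n} {f : Cn n → ℂ} (h : rep φ =ᶠ[𝓝 0] f) :
    lineOrder v φ = analyticOrderAt (fun t : ℂ => f (t • v)) 0 :=
  analyticOrderAt_congr ((tendsto_line v).eventually h)

theorem lineOrder_mul (v : Cn n) (φ ψ : GermRing n) :
    lineOrder v (φ * ψ) = lineOrder v φ + lineOrder v ψ :=
  (lineOrder_eq (rep_mul φ ψ)).trans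
    (analyticOrderAt_mul (analyticAt_line φ v) (analyticAt_line ψ v))

theorem le_lineOrder_add {v : Cn n} {φ ψ : GermRing n} {k : ℕ∞} (hφ : k ≤ lineOrder v φ)
    (hψ : k ≤ lineOrder v ψ) : k ≤ lineOrder v (φ + ψ) := by
  rw [lineOrder_eq (rep_add φ ψ)]
  exact (le_min hφ hψ).trans (le_analyticOrderAt_add
    (f := fun t : ℂ => rep φ (t • v)) (g := fun t : ℂ => rep ψ (t • v)))

theorem lineOrder_eq_zero {v : Cn n} {φ : GermRing n} : lineOrder v φ = 0 ↔ value n φ ≠ 0 := by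
  rw [lineOrder, (analyticAt_line φ v).analyticOrderAt_eq_zero, zero_smul, value_apply]

theorem le_lineOrder_of_mem_pow {φ : GermRing n} {k : ℕ}
    (h : φ ∈ IsLocalRing.maximalIdeal (GermRing n) ^ k) (v : Cn n) : (k : ℕ∞) ≤ lineOrder v φ := by
  induction k generalizing φ with
  | zero => simp
  | succ k ih =>
    rw [pow_succ] at h
    induction h using Submodule.mul_induction_on' with
    | mem_mul_mem a ha b hb =>
      rw [lineOrder_mul, Nat.cast_succ]
      refine add_le_add (ih ha) (Order.one_le_iff_ne_zero.2 fun h0 => ?_)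
      exact lineOrder_eq_zero.1 h0 (mem_maximalIdeal.1 hb)
    | add a _ b _ ha hb => exact le_lineOrder_add ha hb

theorem exists_lineOrder_ne_top {φ : GermRing n} (T : Cn n →L[ℂ] Cn n)
    (h : ¬ ∀ᶠ y in 𝓝 0, rep φ (T y) = 0) : ∃ v, lineOrder (T v) φ ≠ ⊤ := by
  by_contra! hcon
  apply h
  refine AnalyticAt.eventually_eq_zero_of_lines (AnalyticAt.fun_comp (g := rep φ)
    (by rw [map_zero]; exact analyticAt_rep φ) (T.analyticAt 0)) fun v => ?_
  have := analyticOrderAt_eq_top.1 (hcon v)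
  simpa using this

theorem exists_lineOrder_ne_top' {φ : GermRing n} (h : φ ≠ 0) : ∃ v, lineOrder v φ ≠ ⊤ :=
  exists_lineOrder_ne_top (ContinuousLinearMap.id ℂ (Cn n)) (fun h0 => h (eq_zero_iff.2 h0))

theorem eq_zero_of_forall_mem_pow {φ : GermRing n}
    (h : ∀ k, φ ∈ IsLocalRing.maximalIdeal (GermRing n) ^ k) : φ = 0 := by
  by_contra h0
  obtain ⟨v, hv⟩ := exists_lineOrder_ne_top' h0
  exact hv (ENat.eq_top_iff_forall_ge.2 fun k => le_lineOrder_of_mem_pow (h k) v)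

theorem analyticAt_fderiv_rep (v : Cn n) (φ : GermRing n) :
    AnalyticAt ℂ (fun y => fderiv ℂ (rep φ) y v) 0 :=
  AnalyticAt.clm_apply_fun (analyticAt_rep φ).fderiv analyticAt_const

theorem eventually_fderiv_eq {φ : GermRing n} {f : Cn n → ℂ} (h : rep φ =ᶠ[𝓝 0] f) :
    ∀ᶠ y in 𝓝 0, fderiv ℂ (rep φ) y = fderiv ℂ f y := by
  filter_upwards [h.eventuallyEq_nhds] with y hy
  exact hy.fderiv_eq

theorem eventually_differentiableAt (φ : GermRing n) :
    ∀ᶠ y in 𝓝 0, DifferentiableAt ℂ (rep φ) y :=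
  (analyticAt_rep φ).eventually_analyticAt.mono fun _ h => h.differentiableAt

/-- The directional derivative. -/
def dir (v : Cn n) : Derivation ℂ (GermRing n) (GermRing n) :=
  Derivation.mk'
    { toFun := fun φ => mk _ (analyticAt_fderiv_rep v φ)
      map_add' := fun φ ψ => by
        rw [eq_comm, eq_mk_iff]
        filter_upwards [rep_add (mk _ (analyticAt_fderiv_rep v φ))
          (mk _ (analyticAt_fderiv_rep v ψ)), rep_mk (analyticAt_fderiv_rep v φ),
          rep_mk (analyticAt_fderiv_rep v ψ), eventually_fderiv_eq (rep_add φ ψ),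
          eventually_differentiableAt φ, eventually_differentiableAt ψ] with y h1 h2 h3 h4 h5 h6
        rw [h1, h2, h3, h4, fderiv_fun_add h5 h6]
        rfl
      map_smul' := fun c φ => by
        rw [eq_comm, eq_mk_iff]
        filter_upwards [rep_smul c (mk _ (analyticAt_fderiv_rep v φ)),
          rep_mk (analyticAt_fderiv_rep v φ), eventually_fderiv_eq (rep_smul c φ),
          eventually_differentiableAt φ] with y h1 h2 h3 h4
        rw [RingHom.id_apply, h1, h2, h3, fderiv_const_mul h4]
        rfl }
    (fun φ ψ => by
      change mk _ (analyticAt_fderiv_rep v (φ * ψ)) =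
        φ * mk _ (analyticAt_fderiv_rep v ψ) + ψ * mk _ (analyticAt_fderiv_rep v φ)
      rw [eq_comm, eq_mk_iff]
      filter_upwards [rep_add (φ * mk _ (analyticAt_fderiv_rep v ψ))
        (ψ * mk _ (analyticAt_fderiv_rep v φ)), rep_mul φ (mk _ (analyticAt_fderiv_rep v ψ)),
        rep_mul ψ (mk _ (analyticAt_fderiv_rep v φ)), rep_mk (analyticAt_fderiv_rep v φ),
        rep_mk (analyticAt_fderiv_rep v ψ), eventually_fderiv_eq (rep_mul φ ψ),
        eventually_differentiableAt φ, eventually_differentiableAt ψ]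
        with y h1 h2 h3 h4 h5 h6 h7 h8
      rw [h1, h2, h3, h4, h5, h6, fderiv_fun_mul h7 h8]
      rfl)

theorem rep_dir (v : Cn n) (φ : GermRing n) :
    rep (dir v φ) =ᶠ[𝓝 0] fun y => fderiv ℂ (rep φ) y v :=
  rep_mk (analyticAt_fderiv_rep v φ)

theorem value_dir (v : Cn n) (φ : GermRing n) : value n (dir v φ) = fderiv ℂ (rep φ) 0 v :=
  (rep_dir v φ).eq_of_nhds

theorem dir_X (v : Cn n) (i : Fin n) : dir v (X i) = algebraMap ℂ _ (v i) := by
  rw [eq_iff]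
  filter_upwards [rep_dir v (X i), rep_algebraMap (n := n) (v i), eventually_fderiv_eq (rep_X i)]
    with y h1 h2 h3
  rw [h1, h2, h3]
  have := (ContinuousLinearMap.proj (R := ℂ) (φ := fun _ : Fin n => ℂ) i).hasFDerivAt (x := y)
  exact congrArg (fun T : Cn n →L[ℂ] ℂ => T v) this.fderiv

theorem lineOrder_dir {v : Cn n} {φ : GermRing n} {k : ℕ} (h : lineOrder v φ = k + 1) :
    lineOrder v (dir v φ) = k := by
  have h1 := analyticOrderAt_deriv_of_pos (analyticAt_line φ v) h
  rw [← h1, lineOrder_eq (rep_dir v φ)]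
  refine analyticOrderAt_congr ?_
  filter_upwards [(tendsto_line v).eventually (eventually_differentiableAt φ)] with t ht
  have h2 : HasDerivAt (fun t : ℂ => t • v) v t := by
    simpa using (hasDerivAt_id t).smul_const v
  exact (ht.hasFDerivAt.comp_hasDerivAt t h2).deriv.symm

theorem exists_isUnit_iterate_dir {v : Cn n} {φ : GermRing n} (h : lineOrder v φ ≠ ⊤) :
    ∃ k, IsUnit ((dir v)^[k] φ) := by
  obtain ⟨k, hk⟩ := ENat.ne_top_iff_exists.1 h
  induction k generalizing φ with
  | zero => exact ⟨0, isUnit_iff.2 (lineOrder_eq_zero.1 hk.symm)⟩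
  | succ k ih =>
    have := lineOrder_dir (k := k) hk.symm
    obtain ⟨j, hj⟩ := ih (by rw [this]; exact ENat.natCast_ne_top k) this.symm
    exact ⟨j + 1, hj⟩

/-- A nonunit germ that divides all its derivatives is zero. -/
theorem eq_zero_of_dvd_derivations {a : GermRing n} (ha : ¬ IsUnit a)
    (h : ∀ δ : Derivation ℂ (GermRing n) (GermRing n), a ∣ δ a) : a = 0 := by
  by_contra h0
  obtain ⟨v, hv⟩ := exists_lineOrder_ne_top' h0
  obtain ⟨k, hk⟩ := ENat.ne_top_iff_exists.1 hv
  obtain ⟨c, hc⟩ := h (dir v)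
  cases k with
  | zero => exact ha (isUnit_iff.2 (lineOrder_eq_zero.1 hk.symm))
  | succ k =>
    have h1 := lineOrder_dir (k := k) hk.symm
    rw [hc, lineOrder_mul, ← hk] at h1
    have h2 : ((k + 1 : ℕ) : ℕ∞) ≤ k := h1 ▸ le_self_add
    exact absurd (Nat.cast_le.1 h2) (by omega)

/-- The ideals stable under all derivations killing a coordinate, and containing a power of it,
are generated by a power of it. -/
theorem exists_eq_span_X_pow {i : Fin n} {I : Ideal (GermRing n)}
    (hI : ∀ D : Derivation ℂ (GermRing n) (GermRing n), D (X i) = 0 → ∀ b ∈ I, D b ∈ I)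
    {N : ℕ} (hN : X i ^ N ∈ I) : ∃ e, I = Ideal.span {X i ^ e} := by
  classical
  have hex : ∃ e, ¬ I ≤ Ideal.span {X i ^ (e + 1)} := by
    refine ⟨N, fun h => ?_⟩
    obtain ⟨c, hc⟩ := Ideal.mem_span_singleton.1 (h hN)
    rw [pow_succ, mul_assoc] at hc
    have h1 := mul_left_cancel₀ (pow_ne_zero N (X_ne_zero i)) ((mul_one _).trans hc)
    have h2 := congrArg (value n) h1
    rw [map_mul, map_one, mem_maximalIdeal.1 (X_mem_maximalIdeal i), zero_mul] at h2
    exact one_ne_zero h2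
  have hmin := Nat.find_spec hex
  set e := Nat.find hex with he
  have hle : I ≤ Ideal.span {X i ^ e} := by
    rcases Nat.eq_zero_or_eq_succ_pred e with h0 | h0
    · simp [h0]
    · rw [h0]
      exact not_not.1 (Nat.find_min hex (m := e - 1) (by omega))
  refine ⟨e, le_antisymm hle ?_⟩
  rw [SetLike.not_le_iff_exists] at hmin
  obtain ⟨b, hb, hbe⟩ := hmin
  obtain ⟨c, rfl⟩ := Ideal.mem_span_singleton.1 (hle hb)
  have hc : c ∉ Ideal.span (X '' (({i} : Finset (Fin n)) : Set (Fin n))) := by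
    intro hc
    rw [Finset.coe_singleton, image_singleton, Ideal.mem_span_singleton] at hc
    obtain ⟨d, rfl⟩ := hc
    exact hbe (Ideal.mem_span_singleton.2 ⟨d, by ring⟩)
  rw [mem_span_X_iff] at hc
  obtain ⟨v, hv⟩ := exists_lineOrder_ne_top _ hc
  obtain ⟨k, hk⟩ := exists_isUnit_iterate_dir hv
  set w := zeroOn {i} v with hw
  have hwi : dir w (X i) = 0 := by
    rw [dir_X, hw, zeroOn_apply, if_pos (Finset.mem_singleton_self i), map_zero]
  have hwe : dir w (X i ^ e) = 0 := by
    rw [Derivation.leibniz_pow, hwi, smul_zero, smul_zero]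
  have hit : ∀ j, X i ^ e * (dir w)^[j] c ∈ I := by
    intro j
    induction j with
    | zero => exact hb
    | succ j ih =>
      have := hI (dir w) hwi _ ih
      rwa [Derivation.leibniz, hwe, smul_zero, add_zero, smul_eq_mul,
        ← Function.iterate_succ_apply' (dir w) j c] at this
  rw [Ideal.span_singleton_le_iff_mem]
  exact (Ideal.mul_unit_mem_iff_mem I hk).1 (hit k)

/-- A germ vanishing at the origin, one of whose derivatives is a unit, has nonzero
differential. -/
theorem fderiv_rep_ne_zero {a : GermRing n} (ha : ¬ IsUnit a)
    {δ : Derivation ℂ (GermRing n) (GermRing n)} (h : IsUnit (δ a)) :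
    fderiv ℂ (rep a) 0 ≠ 0 := by
  intro h0
  have ha' : a ∈ Ideal.span (range X) := by
    rw [← maximalIdeal_eq_span]
    exact (IsLocalRing.mem_maximalIdeal a).2 ha
  obtain ⟨q, hq⟩ := Ideal.mem_span_range_iff_exists_fun.1 ha'
  have hval : ∀ D : Derivation ℂ (GermRing n) (GermRing n),
      value n (D a) = ∑ i, value n (q i) * value n (D (X i)) := by
    intro D
    rw [← hq, map_sum, map_sum]
    refine Finset.sum_congr rfl fun i _ => ?_
    rw [Derivation.leibniz, map_add, smul_eq_mul, smul_eq_mul, map_mul, map_mul,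
      mem_maximalIdeal.1 (X_mem_maximalIdeal i), zero_mul, add_zero]
  have hq0 : ∀ i, value n (q i) = 0 := by
    intro i
    have h1 := hval (dir (Pi.single i 1))
    rw [value_dir, h0, Finset.sum_eq_single i] at h1
    · simpa [dir_X] using h1.symm
    · intro j _ hj
      simp [dir_X, hj]
    · exact fun hi => absurd (Finset.mem_univ i) hi
  exact isUnit_iff.1 h ((hval δ).trans (Finset.sum_eq_zero fun i _ => by rw [hq0, zero_mul]))

end GermRing

/-- Nakayama's lemma for generators of a finite algebra over a local ring. -/
theorem RingHom.Finite.exists_eq_sum_of_isLocalRing {A B : Type*} [CommRing A] [CommRing B]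
    [IsLocalRing A] {φ : A →+* B} (hφ : φ.Finite) {ι : Type*} [Fintype ι] (s : ι → B)
    (h : ∀ b, ∃ c : ι → A, b - ∑ j, φ (c j) * s j ∈
      (IsLocalRing.maximalIdeal A).map φ) (b : B) : ∃ c : ι → A, b = ∑ j, φ (c j) * s j := by
  let := φ.toAlgebra
  have : Module.Finite A B := hφ
  have hle : (⊤ : Submodule A B) ≤ LinearMap.range (Fintype.linearCombination A s) ⊔
      IsLocalRing.maximalIdeal A • (⊤ : Submodule A B) := by
    intro b _
    obtain ⟨c, hc⟩ := h b
    rw [← add_sub_cancel (∑ j, φ (c j) * s j) b]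
    refine Submodule.add_mem_sup ⟨c, ?_⟩ ?_
    · rw [Fintype.linearCombination_apply]
      rfl
    · rw [Ideal.smul_top_eq_map]
      exact hc
  have hle' := Submodule.le_of_le_smul_of_le_jacobson_bot Module.Finite.fg_top
    (IsLocalRing.maximalIdeal_le_jacobson _) hle
  obtain ⟨c, hc⟩ := hle' (Submodule.mem_top (x := b))
  refine ⟨c, ?_⟩
  rw [← hc, Fintype.linearCombination_apply]
  rfl

namespace GermRing

variable {n m l : ℕ}

theorem pull_pull {g : Cn n → Cn m} (hg : AnalyticAt ℂ g 0) (hg0 : g 0 = 0) {h : Cn m → Cn l}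
    (hh : AnalyticAt ℂ h 0) (hh0 : h 0 = 0) {k : Cn n → Cn l}
    (hk : AnalyticAt ℂ k 0) (hk0 : k 0 = 0) (hkgh : ∀ᶠ y in 𝓝 0, k y = h (g y)) (φ : GermRing l) :
    pull g hg hg0 (pull h hh hh0 φ) = pull k hk hk0 φ := by
  rw [eq_iff]
  filter_upwards [rep_pull hg hg0 (pull h hh hh0 φ),
    (tendsto_zero hg hg0).eventually (rep_pull hh hh0 φ), rep_pull hk hk0 φ, hkgh] with y h1 h2 h3 h4
  rw [h1, h2, h3, h4]

theorem pull_X {g : Cn n → Cn m} (hg : AnalyticAt ℂ g 0) (hg0 : g 0 = 0) (i : Fin m) :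
    rep (pull g hg hg0 (X i)) =ᶠ[𝓝 0] fun y => g y i := by
  filter_upwards [rep_pull hg hg0 (X i), (tendsto_zero hg hg0).eventually (rep_X i)] with y h1 h2
  rw [h1, h2]

/-- Pullback along a linear map. -/
def pullL (T : Cn n →L[ℂ] Cn m) : GermRing m →ₐ[ℂ] GermRing n :=
  pull T (T.analyticAt 0) (map_zero T)

theorem rep_pullL (T : Cn n →L[ℂ] Cn m) (φ : GermRing m) :
    rep (pullL T φ) =ᶠ[𝓝 0] fun y => rep φ (T y) := rep_pull _ _ φ

theorem value_pullL (T : Cn n →L[ℂ] Cn m) (φ : GermRing m) :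
    value n (pullL T φ) = value m φ := value_pull _ _ φ

theorem pullL_pullL (T : Cn n →L[ℂ] Cn m) (T' : Cn m →L[ℂ] Cn l) (φ : GermRing l) :
    pullL T (pullL T' φ) = pullL (T' ∘L T) φ :=
  pull_pull (T.analyticAt 0) (map_zero T) (T'.analyticAt 0) (map_zero T')
    ((T' ∘L T).analyticAt 0) (map_zero (T' ∘L T)) (Eventually.of_forall fun _ => rfl) φ

theorem pullL_zeroOn_eq_zero_iff (s : Finset (Fin n)) (φ : GermRing n) :
    pullL (zeroOn s) φ = 0 ↔ φ ∈ Ideal.span (X '' (s : Set (Fin n))) := by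
  rw [mem_span_X_iff, eq_zero_iff]
  exact eventually_congr ((rep_pullL (zeroOn s) φ).mono fun y hy => by rw [hy])

theorem pullL_zeroOn_X_of_mem {s : Finset (Fin n)} {i : Fin n} (hi : i ∈ s) :
    pullL (zeroOn s) (X i) = 0 :=
  (pullL_zeroOn_eq_zero_iff s _).2 (Ideal.subset_span ⟨i, hi, rfl⟩)

theorem pullL_zeroOn_X_of_notMem {s : Finset (Fin n)} {i : Fin n} (hi : i ∉ s) :
    pullL (zeroOn s) (X i) = X i := by
  rw [eq_iff]
  filter_upwards [rep_pullL (zeroOn s) (X i), rep_X i,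
    (tendsto_clm_zero (zeroOn s)).eventually (rep_X i)] with y h1 h2 h3
  rw [h1, h2, h3, zeroOn_apply, if_neg hi]

theorem sub_pullL_zeroOn_mem (s : Finset (Fin n)) (φ : GermRing n) :
    φ - pullL (zeroOn s) φ ∈ Ideal.span (X '' (s : Set (Fin n))) := by
  have : zeroOn s ∘L zeroOn s = zeroOn s := by
    ext y i
    by_cases hi : i ∈ s <;> simp [zeroOn_apply, hi]
  rw [← pullL_zeroOn_eq_zero_iff, map_sub, pullL_pullL, this, sub_self]

/-- Forget the first coordinate. -/
def tailL (n : ℕ) : Cn (n + 1) →L[ℂ] Cn n :=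
  ContinuousLinearMap.pi fun i => ContinuousLinearMap.proj i.succ

/-- Insert zero as the first coordinate. -/
def consZeroL (n : ℕ) : Cn n →L[ℂ] Cn (n + 1) :=
  ContinuousLinearMap.pi (Fin.cons 0 fun i => ContinuousLinearMap.proj i)

theorem tailL_apply (y : Cn (n + 1)) (i : Fin n) : tailL n y i = y i.succ := rfl

theorem consZeroL_zero (y : Cn n) : consZeroL n y 0 = 0 := rfl

theorem consZeroL_succ (y : Cn n) (i : Fin n) : consZeroL n y i.succ = y i := rfl

theorem pullL_tailL_X (i : Fin n) : pullL (tailL n) (X i) = X i.succ := by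
  rw [eq_iff]
  filter_upwards [pull_X ((tailL n).analyticAt 0) (map_zero _) i, rep_X i.succ] with y h1 h2
  rw [h2]
  exact h1

/-- The projection onto the first coordinate axis. -/
def axis (n : ℕ) : Cn (n + 1) →L[ℂ] Cn (n + 1) := zeroOn (Finset.univ.erase 0)

theorem axis_comp_tailL : tailL n ∘L axis n = 0 := by
  ext y i
  simp [tailL_apply, axis, zeroOn_apply, Fin.succ_ne_zero]

theorem pullL_axis_tailL (r : GermRing n) :
    pullL (axis n) (pullL (tailL n) r) = algebraMap ℂ _ (value n r) := by
  rw [pullL_pullL, axis_comp_tailL, eq_iff]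
  filter_upwards [rep_pullL (0 : Cn (n + 1) →L[ℂ] Cn n) r,
    rep_algebraMap (n := n + 1) (value n r)] with y h1 h2
  rw [h1, h2]
  rfl

theorem pullL_axis_X_zero : pullL (axis n) (X 0) = X 0 := pullL_zeroOn_X_of_notMem (by simp)

theorem pullL_axis_X_of_ne {i : Fin (n + 1)} (hi : i ≠ 0) : pullL (axis n) (X i) = 0 :=
  pullL_zeroOn_X_of_mem (by simp [hi])

/-- A germ that does not vanish on the first axis is a power times a unit there. -/
theorem exists_pullL_axis_eq {φ : GermRing (n + 1)} (h : pullL (axis n) φ ≠ 0) :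
    ∃ (d : ℕ) (e : GermRing (n + 1)), IsUnit e ∧ pullL (axis n) φ = X 0 ^ d * e := by
  by_contra! hcon
  have key : ∀ k : ℕ, ∃ ψ, pullL (axis n) φ = X 0 ^ k * pullL (axis n) ψ := by
    intro k
    induction k with
    | zero => exact ⟨φ, by simp⟩
    | succ k ih =>
      obtain ⟨ψ, hψ⟩ := ih
      have h1 : ψ ∈ Ideal.span (range X) := by
        rw [← maximalIdeal_eq_span, mem_maximalIdeal]
        by_contra h2
        exact hcon k _ (isUnit_iff.2 (by rwa [value_pullL])) hψ
      obtain ⟨q, rfl⟩ := Ideal.mem_span_range_iff_exists_fun.1 h1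
      refine ⟨q 0, ?_⟩
      rw [hψ, map_sum, Finset.sum_eq_single 0]
      · rw [map_mul, pullL_axis_X_zero]
        ring
      · intro i _ hi
        rw [map_mul, pullL_axis_X_of_ne hi, mul_zero]
      · exact fun hi => absurd (Finset.mem_univ _) hi
  refine h (eq_zero_of_forall_mem_pow fun k => ?_)
  obtain ⟨ψ, hψ⟩ := key k
  rw [hψ]
  exact Ideal.mul_mem_right _ _ (Ideal.pow_mem_pow (X_mem_maximalIdeal 0) k)

open Polynomial in
theorem polynomial_eq_zero_of_aeval_eq {p : ℂ[X]} {d : ℕ} (hp : p.degree < d)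
    {h : GermRing (n + 1)} (hph : aeval (GermRing.X 0 : GermRing (n + 1)) p = GermRing.X 0 ^ d * h) :
    p = 0 := by
  by_contra h0
  obtain ⟨q, hq, hdvd⟩ := p.exists_eq_pow_rootMultiplicity_mul_and_not_dvd h0 0
  set k := p.rootMultiplicity 0 with hk
  rw [map_zero, sub_zero] at hq hdvd
  have hkd : k < d := by
    have h1 : k ≤ p.natDegree := by
      rw [← natDegree_X_pow (R := ℂ) k]
      exact natDegree_le_of_dvd ⟨q, hq⟩ h0
    have h2 : p.natDegree < d := (natDegree_lt_iff_degree_lt h0).2 hp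
    omega
  rw [hq, map_mul, map_pow, aeval_X] at hph
  obtain ⟨c, rfl⟩ : ∃ c, d = k + (c + 1) := ⟨d - k - 1, by omega⟩
  rw [pow_add, mul_assoc] at hph
  have h1 := mul_left_cancel₀ (pow_ne_zero k (X_ne_zero 0)) hph
  have h2 := congrArg (value (n + 1)) h1
  rw [pow_succ, map_mul, map_mul, mem_maximalIdeal.1 (X_mem_maximalIdeal 0), mul_zero, zero_mul,
    ← aeval_algHom_apply, mem_maximalIdeal.1 (X_mem_maximalIdeal 0)] at h2
  exact hdvd (X_dvd_iff.2 (by simpa [coeff_zero_eq_eval_zero] using h2))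

/-- The germ of an analytic function, as a ring homomorphism. -/
def germ (n : ℕ) : analyticFunctions n →+* GermRing n := Ideal.Quotient.mk (vanishingIdeal n)

theorem germ_apply (f : analyticFunctions n) : germ n f = mk f (show AnalyticAt ℂ (f : Cn n → ℂ) 0 from f.2) := rfl

theorem rep_germ (f : analyticFunctions n) : rep (germ n f) =ᶠ[𝓝 0] f :=
  rep_mk (show AnalyticAt ℂ (f : Cn n → ℂ) 0 from f.2)

theorem germ_surjective : Function.Surjective (germ n) := Ideal.Quotient.mk_surjective

/-- Evaluation of functions at a point. -/
def evalAt (a : Cn n) : analyticFunctions n →+* ℂ :=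
  (Pi.evalRingHom (fun _ : Cn n => ℂ) a).comp (analyticFunctions n).val.toRingHom

theorem evalAt_apply (a : Cn n) (f : analyticFunctions n) : evalAt a f = (f : Cn n → ℂ) a := rfl

/-- A polynomial in the first coordinate, with coefficients analytic in the others. -/
def polyGerm (n : ℕ) : Polynomial (analyticFunctions n) →+* GermRing (n + 1) :=
  Polynomial.eval₂RingHom ((pullL (tailL n) : GermRing n →+* GermRing (n + 1)).comp (germ n)) (X 0)

theorem polyGerm_C (f : analyticFunctions n) :
    polyGerm n (Polynomial.C f) = pullL (tailL n) (germ n f) := by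
  simp [polyGerm]

theorem polyGerm_X : polyGerm n Polynomial.X = X 0 := by
  simp [polyGerm]

theorem rep_polyGerm (p : Polynomial (analyticFunctions n)) :
    rep (polyGerm n p) =ᶠ[𝓝 0] fun y => (p.map (evalAt (tailL n y))).eval (y 0) := by
  induction p using Polynomial.induction_on' with
  | add p q hp hq =>
    rw [map_add]
    filter_upwards [rep_add (polyGerm n p) (polyGerm n q), hp, hq] with y h1 h2 h3
    rw [h1, h2, h3, Polynomial.map_add, Polynomial.eval_add]
  | monomial k f =>
    rw [← Polynomial.C_mul_X_pow_eq_monomial, map_mul, map_pow, polyGerm_C, polyGerm_X]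
    filter_upwards [rep_mul (pullL (tailL n) (germ n f)) (X 0 ^ k),
      rep_pullL (tailL n) (germ n f), (tendsto_clm_zero (tailL n)).eventually (rep_germ f),
      rep_pow (X 0 : GermRing (n + 1)) k, rep_X (0 : Fin (n + 1))] with y h1 h2 h3 h4 h5
    rw [h1, h2, h3, h4, h5]
    simp [evalAt_apply]

theorem pullL_axis_polyGerm (p : Polynomial (analyticFunctions n)) :
    pullL (axis n) (polyGerm n p) = Polynomial.aeval (X 0) (p.map (evalAt 0)) := by
  induction p using Polynomial.induction_on' with
  | add p q hp hq => rw [map_add, map_add, hp, hq, Polynomial.map_add, map_add]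
  | monomial k f =>
    rw [← Polynomial.C_mul_X_pow_eq_monomial, map_mul, map_pow, polyGerm_C, polyGerm_X, map_mul,
      map_pow, pullL_axis_tailL, pullL_axis_X_zero]
    simp only [Polynomial.map_mul, Polynomial.map_pow, Polynomial.map_C, Polynomial.map_X, map_mul,
      map_pow, Polynomial.aeval_C, Polynomial.aeval_X]
    rw [germ_apply, value_mk, evalAt_apply]

open Polynomial in
/-- Weierstrass division. -/
theorem exists_weierstrass_division {f e : GermRing (n + 1)} {d : ℕ} (hf0 : value (n + 1) f = 0)
    (he : IsUnit e) (hfe : pullL (axis n) f = GermRing.X 0 ^ d * e) (h : GermRing (n + 1)) :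
    ∃ (q : GermRing (n + 1)) (p : (analyticFunctions n)[X]), p.degree < d ∧
      h = q * f + polyGerm n p := by
  let Φ : Cn (n + 1) → Cn (n + 1) := fun y => Fin.cons (rep f y) (tailL n y)
  have hΦ : AnalyticAt ℂ Φ 0 := by
    rw [analyticAt_pi_iff]
    intro i
    refine Fin.cases ?_ (fun j => ?_) i
    · exact analyticAt_rep f
    · exact analyticAt_coord j.succ 0
  have hΦ0 : Φ 0 = 0 := by
    funext i
    refine Fin.cases ?_ (fun j => ?_) i
    · exact hf0
    · rfl
  set P := pull Φ hΦ hΦ0 with hP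
  have hP0 : P (GermRing.X 0) = f := by
    rw [eq_iff]
    exact pull_X hΦ hΦ0 0
  have hPs : ∀ j : Fin n, P (GermRing.X j.succ) = GermRing.X j.succ := by
    intro j
    rw [eq_iff]
    exact (pull_X hΦ hΦ0 j.succ).trans (rep_X j.succ).symm
  set I := Ideal.span (range fun i => P (GermRing.X i)) with hI
  have hfI : f ∈ I := hP0 ▸ Ideal.subset_span ⟨0, rfl⟩
  have hXI : ∀ j : Fin (n + 1), j ≠ 0 → GermRing.X j ∈ I := by
    intro j hj
    obtain ⟨i, rfl⟩ := Fin.exists_succ_eq.2 hj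
    exact hPs i ▸ Ideal.subset_span ⟨i.succ, rfl⟩
  have hsub : ∀ φ, φ - pullL (axis n) φ ∈ I := by
    intro φ
    refine Ideal.span_le.2 ?_ (sub_pullL_zeroOn_mem (Finset.univ.erase 0) φ)
    rintro _ ⟨j, hj, rfl⟩
    exact hXI j (by simpa using hj)
  have hζ : GermRing.X 0 ^ d ∈ I := by
    have h1 := I.sub_mem hfI (hsub f)
    rw [sub_sub_cancel, hfe] at h1
    exact (Ideal.mul_unit_mem_iff_mem I he).1 h1
  have hrad : IsLocalRing.maximalIdeal (GermRing (n + 1)) ≤ I.radical := by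
    rw [maximalIdeal_eq_span, Ideal.span_le]
    rintro _ ⟨j, rfl⟩
    by_cases hj : j = 0
    · exact ⟨d, hj ▸ hζ⟩
    · exact Ideal.le_radical (hXI j hj)
  obtain ⟨K, hK⟩ := Ideal.exists_pow_le_of_le_radical_of_fg hrad
    (by rw [maximalIdeal_eq_span]; exact Submodule.fg_span (finite_range _))
  have hfin := finite_pull hΦ hΦ0 hK
  have hmap : (IsLocalRing.maximalIdeal (GermRing (n + 1))).map
      (P : GermRing (n + 1) →+* GermRing (n + 1)) = I := by
    rw [maximalIdeal_eq_span, Ideal.map_span, hI, ← range_comp]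
    rfl
  have hexp : ∀ (k : ℕ) (φ : GermRing (n + 1)), ∃ (c : Fin k → ℂ) (ψ : GermRing (n + 1)),
      φ - ∑ j, algebraMap ℂ _ (c j) * GermRing.X 0 ^ (j : ℕ) - GermRing.X 0 ^ k * ψ ∈ I := by
    intro k
    induction k with
    | zero => exact fun φ => ⟨Fin.elim0, φ, by simp⟩
    | succ k ih =>
      intro φ
      obtain ⟨c, ψ, hc⟩ := ih φ
      have h1 : ψ - algebraMap ℂ _ (value (n + 1) ψ) ∈ Ideal.span (range GermRing.X) := by
        rw [← maximalIdeal_eq_span, mem_maximalIdeal, map_sub, AlgHom.commutes]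
        exact sub_self _
      obtain ⟨q, hq⟩ := Ideal.mem_span_range_iff_exists_fun.1 h1
      refine ⟨Fin.snoc c (value (n + 1) ψ), q 0, ?_⟩
      rw [Fin.sum_univ_succ] at hq
      rw [Fin.sum_univ_castSucc]
      simp only [Fin.snoc_castSucc, Fin.val_castSucc, Fin.snoc_last, Fin.val_last]
      have h2 : ∑ i : Fin n, q i.succ * GermRing.X i.succ ∈ I :=
        sum_mem fun i _ => I.mul_mem_left _ (hXI _ (Fin.succ_ne_zero i))
      have h3 := I.add_mem hc (I.mul_mem_left (GermRing.X 0 ^ k) h2)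
      convert h3 using 1
      rw [pow_succ]
      linear_combination (-GermRing.X 0 ^ k) * hq
  obtain ⟨c, hc⟩ := hfin.exists_eq_sum_of_isLocalRing
    (fun j : Fin d => (GermRing.X 0 : GermRing (n + 1)) ^ (j : ℕ)) (fun φ => by
      obtain ⟨c, ψ, hc⟩ := hexp d φ
      refine ⟨fun j => algebraMap ℂ _ (c j), ?_⟩
      rw [hmap]
      have h1 := I.add_mem hc (I.mul_mem_right ψ hζ)
      rw [sub_add_cancel] at h1
      simpa using h1) h
  have hred : ∀ a : GermRing (n + 1), ∃ (q : GermRing (n + 1)) (r : analyticFunctions n),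
      P a = q * f + pullL (tailL n) (germ n r) := by
    intro a
    obtain ⟨r, hr⟩ := germ_surjective (pullL (consZeroL n) a)
    have h1 : a - pullL (tailL n) (pullL (consZeroL n) a) ∈
        Ideal.span (GermRing.X '' (({0} : Finset (Fin (n + 1))) : Set (Fin (n + 1)))) := by
      have h2 : consZeroL n ∘L (tailL n ∘L zeroOn {0}) = zeroOn {0} := by
        ext y i
        refine Fin.cases ?_ (fun j => ?_) i
        · simp [consZeroL_zero, zeroOn_apply]
        · simp [consZeroL_succ, tailL_apply, zeroOn_apply, Fin.succ_ne_zero]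
      rw [← pullL_zeroOn_eq_zero_iff, map_sub, pullL_pullL, pullL_pullL, h2, sub_self]
    rw [Finset.coe_singleton, image_singleton, Ideal.mem_span_singleton] at h1
    obtain ⟨q, hq⟩ := h1
    refine ⟨P q, r, ?_⟩
    have h3 : P (pullL (tailL n) (pullL (consZeroL n) a)) =
        pullL (tailL n) (pullL (consZeroL n) a) :=
      pull_pull hΦ hΦ0 _ _ _ _ (Eventually.of_forall fun y => rfl) _
    rw [hr, ← h3, ← sub_eq_iff_eq_add, ← map_sub, hq, map_mul, hP0, mul_comm]
  choose q r hqr using fun j => hred (c j)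
  refine ⟨∑ j, q j * GermRing.X 0 ^ (j : ℕ), ∑ j, C (r j) * Polynomial.X ^ (j : ℕ), ?_, ?_⟩
  · refine (degree_sum_le _ _).trans_lt ((Finset.sup_lt_iff (WithBot.bot_lt_coe d)).2 fun j _ => ?_)
    exact (degree_C_mul_X_pow_le _ _).trans_lt (Nat.cast_lt.2 j.2)
  · rw [hc, Finset.sum_mul, map_sum, ← Finset.sum_add_distrib]
    refine Finset.sum_congr rfl fun j _ => ?_
    rw [map_mul, map_pow, polyGerm_C, polyGerm_X]
    have h1 := hqr j
    change P (c j) * _ = _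
    rw [h1]
    ring

end GermRing

namespace Polynomial

/-- A monic polynomial whose resultants with enough members of the pencil `∑ i, c ^ i • p i`
vanish has a common root with all the `p i`. -/
theorem exists_common_root_of_resultant_eq_zero {N d M : ℕ} {W : ℂ[X]} (hW : W.Monic)
    (hWd : W.natDegree = d) {p : Fin N → ℂ[X]} (hp : ∀ i, (p i).natDegree ≤ d)
    (hM : d * N < M)
    (h : ∀ j : Fin M, resultant W (∑ i : Fin N, C ((j : ℂ) ^ (i : ℕ)) * p i) d d = 0) :
    ∃ ζ, W.eval ζ = 0 ∧ ∀ i, (p i).eval ζ = 0 := by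
  have h1 : ∀ j : Fin M, ∃ ζ ∈ W.roots.toFinset,
      ∑ i : Fin N, (j : ℂ) ^ (i : ℕ) * (p i).eval ζ = 0 := by
    intro j
    have h2 := h j
    subst hWd
    rw [resultant_eq_prod_eval _ _ _ (natDegree_sum_le_of_forall_le _ _ fun i _ =>
      (natDegree_C_mul_le _ _).trans (hp i)) (IsAlgClosed.splits W), hW.leadingCoeff, one_pow,
      one_mul, Multiset.prod_eq_zero_iff, Multiset.mem_map] at h2
    obtain ⟨ζ, hζ, hζ0⟩ := h2
    exact ⟨ζ, Multiset.mem_toFinset.2 hζ, by simpa [eval_finsetSum] using hζ0⟩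
  choose ζ hζ hζ0 using h1
  have hcard : W.roots.toFinset.card * N < (Finset.univ : Finset (Fin M)).card := by
    rw [Finset.card_univ, Fintype.card_fin]
    refine (Nat.mul_le_mul_right N ?_).trans_lt hM
    exact hWd ▸ (Multiset.toFinset_card_le _).trans (card_roots' W)
  obtain ⟨z, hz, hcz⟩ := Finset.exists_lt_card_fiber_of_mul_lt_card_of_maps_to
    (f := ζ) (fun j _ => hζ j) hcard
  refine ⟨z, (mem_roots'.1 (Multiset.mem_toFinset.1 hz)).2, ?_⟩
  have hQ : (∑ i : Fin N, C ((p i).eval z) * X ^ (i : ℕ) : ℂ[X]) = 0 := by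
    refine eq_zero_of_natDegree_lt_card_of_eval_eq_zero' _
      ((Finset.univ.filter fun j => ζ j = z).image fun j : Fin M => (j : ℂ)) ?_ ?_
    · intro x hx
      obtain ⟨j, hj, rfl⟩ := Finset.mem_image.1 hx
      have h3 := hζ0 j
      rw [(Finset.mem_filter.1 hj).2] at h3
      rw [← h3, eval_finsetSum]
      refine Finset.sum_congr rfl fun i _ => ?_
      rw [eval_mul, eval_C, eval_pow, eval_X, mul_comm]
    · rw [Finset.card_image_of_injective _ fun a b hab => Fin.ext (Nat.cast_injective hab)]
      refine lt_of_le_of_lt (natDegree_sum_le_of_forall_le _ _ fun i _ => ?_) hcz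
      exact (natDegree_C_mul_X_pow_le _ _).trans i.2.le
  intro i
  have h4 := congrArg (fun q => q.coeff (i : ℕ)) hQ
  simpa [finsetSum_coeff, coeff_C_mul, coeff_X_pow, Fin.val_inj] using h4

/-- Roots of a polynomial `X ^ d - p` with small lower coefficients are small. -/
theorem norm_lt_of_pow_eq_eval {d : ℕ} {p : ℂ[X]} (hp : p.degree < d) {δ : ℝ} (hδ0 : 0 < δ)
    (hδ1 : δ ≤ 1) (h : ∑ j ∈ Finset.range d, ‖p.coeff j‖ < δ ^ d) {ζ : ℂ}
    (hζ : ζ ^ d = p.eval ζ) : ‖ζ‖ < δ := by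
  by_contra! hcon
  have hpos : 0 < ‖ζ‖ ^ d := pow_pos (hδ0.trans_le hcon) d
  rcases eq_or_ne p 0 with rfl | hp0
  · rw [eval_zero] at hζ
    rw [← norm_pow, hζ, norm_zero] at hpos
    exact hpos.false
  rw [eval_eq_sum_range' ((natDegree_lt_iff_degree_lt hp0).2 hp)] at hζ
  have h1 : ‖ζ‖ ^ d ≤ ∑ j ∈ Finset.range d, ‖p.coeff j‖ * ‖ζ‖ ^ j := by
    rw [← norm_pow, hζ]
    exact (norm_sum_le _ _).trans_eq (Finset.sum_congr rfl fun j _ => by rw [norm_mul, norm_pow])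
  rcases le_or_gt ‖ζ‖ 1 with h2 | h2
  · have h3 : ∑ j ∈ Finset.range d, ‖p.coeff j‖ * ‖ζ‖ ^ j ≤ ∑ j ∈ Finset.range d, ‖p.coeff j‖ :=
      Finset.sum_le_sum fun j _ =>
        mul_le_of_le_one_right (norm_nonneg _) (pow_le_one₀ (norm_nonneg _) h2)
    exact absurd (pow_le_pow_left₀ hδ0.le hcon d) (not_le.2 ((h1.trans h3).trans_lt h))
  · have h3 : ∑ j ∈ Finset.range d, ‖p.coeff j‖ * ‖ζ‖ ^ j ≤
        (∑ j ∈ Finset.range d, ‖p.coeff j‖) * ‖ζ‖ ^ d := by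
      rw [Finset.sum_mul]
      exact Finset.sum_le_sum fun j hj => mul_le_mul_of_nonneg_left
        (pow_le_pow_right₀ h2.le (Finset.mem_range.1 hj).le) (norm_nonneg _)
    have h4 := h.trans_le (pow_le_one₀ hδ0.le hδ1)
    exact absurd (h1.trans h3) (not_le.2 (mul_lt_of_lt_one_left hpos h4))

end Polynomial

namespace GermRing

variable {n : ℕ}

open Polynomial in
theorem maximalIdeal_le_radical_of_axis
    (ih : ∀ (M : ℕ) (H : Fin M → GermRing n),
      (∀ᶠ y in 𝓝 0, (∀ j, rep (H j) y = 0) → y = 0) →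
      IsLocalRing.maximalIdeal (GermRing n) ≤ (Ideal.span (range H)).radical)
    {N : ℕ} {G : Fin N → GermRing (n + 1)}
    (hG : ∀ᶠ y in 𝓝 0, (∀ i, rep (G i) y = 0) → y = 0) {i₀ : Fin N}
    (hf0 : value (n + 1) (G i₀) = 0) (hf : pullL (axis n) (G i₀) ≠ 0) :
    IsLocalRing.maximalIdeal (GermRing (n + 1)) ≤ (Ideal.span (range G)).radical := by
  obtain ⟨d, e, he, hfe⟩ := exists_pullL_axis_eq hf
  set f := G i₀ with hfdef
  have hd : d ≠ 0 := by
    rintro rfl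
    rw [pow_zero, one_mul] at hfe
    have h1 := isUnit_iff.1 he
    rw [← hfe, value_pullL] at h1
    exact h1 hf0
  obtain ⟨q, p, hp, hqp⟩ := exists_weierstrass_division hf0 he hfe (GermRing.X 0 ^ d)
  have hax := congrArg (pullL (axis n)) hqp
  rw [map_pow, pullL_axis_X_zero, map_add, map_mul, hfe, pullL_axis_polyGerm] at hax
  have hp0 : p.map (evalAt 0) = 0 := by
    refine polynomial_eq_zero_of_aeval_eq (degree_map_le.trans_lt hp)
      (h := 1 - pullL (axis n) q * e) ?_
    linear_combination (-1 : GermRing (n + 1)) * hax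
  have hq : value (n + 1) q ≠ 0 := by
    rw [hp0, map_zero, add_zero] at hax
    have h1 : pullL (axis n) q * e = 1 :=
      mul_left_cancel₀ (pow_ne_zero d (X_ne_zero 0)) (by linear_combination -hax)
    rw [← value_pullL (axis n)]
    exact isUnit_iff.1 (IsUnit.of_mul_eq_one _ h1)
  set W : (analyticFunctions n)[X] := Polynomial.X ^ d - p with hW
  have hWm : W.Monic := (monic_X_pow d).sub_of_left (by rwa [degree_X_pow])
  have hWd : W.natDegree = d := by
    refine natDegree_eq_of_degree_eq_some ?_
    rw [hW, degree_sub_eq_left_of_degree_lt (by rwa [degree_X_pow]), degree_X_pow]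
  have hWf : polyGerm n W = q * f := by
    have h1 := congrArg (polyGerm n) (sub_add_cancel (Polynomial.X ^ d) p)
    rw [map_add, map_pow, polyGerm_X, hqp] at h1
    exact add_right_cancel h1
  choose a r hr har using fun i => exists_weierstrass_division hf0 he hfe (G i)
  set I := Ideal.span (range G) with hI
  have hGI : ∀ i, G i ∈ I := fun i => Ideal.subset_span ⟨i, rfl⟩
  let P : Fin (d * N + 1) → (analyticFunctions n)[X] :=
    fun j => ∑ i : Fin N, C ((j : analyticFunctions n) ^ (i : ℕ)) * r i
  let R : Fin (d * N + 1) → analyticFunctions n := fun j => resultant W (P j) d d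
  have hrd : ∀ i, (r i).natDegree ≤ d := fun i => natDegree_le_of_degree_le (hr i).le
  have hRI : ∀ j, pullL (tailL n) (germ n (R j)) ∈ I := by
    intro j
    obtain ⟨u, v, -, -, huv⟩ := exists_mul_add_mul_eq_C_resultant W (P j) hWd.le
      (natDegree_sum_le_of_forall_le _ _ fun i _ => (natDegree_C_mul_le _ _).trans (hrd i))
      (Or.inl hd)
    rw [← polyGerm_C, ← huv, map_add, map_mul, map_mul, hWf]
    refine I.add_mem (I.mul_mem_right _ (I.mul_mem_left _ (hGI i₀))) (I.mul_mem_right _ ?_)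
    rw [map_sum]
    refine I.sum_mem fun i _ => ?_
    rw [map_mul]
    refine I.mul_mem_left _ ?_
    rw [← sub_eq_of_eq_add' (har i)]
    exact I.sub_mem (hGI i) (I.mul_mem_left _ (hGI i₀))
  have hzero : ∀ᶠ y in 𝓝 0, (∀ j, rep (germ n (R j)) y = 0) → y = 0 := by
    have hE : ∀ᶠ y in 𝓝 (0 : Cn (n + 1)), ((∀ i, rep (G i) y = 0) → y = 0) ∧
        (∀ i, rep (G i) y = rep (a i) y * rep f y +
          ((r i).map (evalAt (tailL n y))).eval (y 0)) ∧
        rep q y * rep f y = (W.map (evalAt (tailL n y))).eval (y 0) ∧ rep q y ≠ 0 := by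
      have h1 : ∀ᶠ y in 𝓝 (0 : Cn (n + 1)), ∀ i, rep (G i) y = rep (a i) y * rep f y +
          ((r i).map (evalAt (tailL n y))).eval (y 0) := by
        rw [eventually_all]
        intro i
        have h2 : rep (G i) =ᶠ[𝓝 0] rep (a i * f + polyGerm n (r i)) :=
          Eventually.of_forall fun y => by rw [← har i]
        filter_upwards [h2, rep_add (a i * f) (polyGerm n (r i)), rep_mul (a i) f,
          rep_polyGerm (r i)] with y h2 h3 h4 h5
        rw [h2, h3, h4, h5]
      filter_upwards [hG, h1, rep_mul q f, rep_polyGerm W,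
        (analyticAt_rep q).continuousAt.eventually_ne (value_apply q ▸ hq)] with y h2 h3 h4 h5 h6
      exact ⟨h2, h3, by rw [← h4, ← hWf, h5], h6⟩
    obtain ⟨δ₀, hδ₀, hball⟩ := Metric.eventually_nhds_iff.1 hE
    set δ := min δ₀ 1 with hδ
    have hδ0 : 0 < δ := lt_min hδ₀ one_pos
    have hsmall : ∀ᶠ b in 𝓝 (0 : Cn n),
        ∑ j ∈ Finset.range d, ‖(p.map (evalAt b)).coeff j‖ < δ ^ d := by
      have hc : ContinuousAt (fun b : Cn n =>
          ∑ j ∈ Finset.range d, ‖(p.map (evalAt b)).coeff j‖) 0 := by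
        refine tendsto_finsetSum _ fun j _ => ContinuousAt.norm ?_
        simp only [coeff_map, evalAt_apply]
        exact (show AnalyticAt ℂ ((p.coeff j : analyticFunctions n) : Cn n → ℂ) 0 from
          (p.coeff j).2).continuousAt
      refine hc.eventually_lt_const ?_
      simpa [hp0] using pow_pos hδ0 d
    filter_upwards [hsmall, Metric.ball_mem_nhds (0 : Cn n) hδ0,
      eventually_all.2 fun j => rep_germ (R j)] with b hb1 hb2 hb3 hb4
    have hWb : W.map (evalAt b) = Polynomial.X ^ d - p.map (evalAt b) := by
      rw [hW, Polynomial.map_sub, Polynomial.map_pow, map_X]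
    obtain ⟨ζ, hζ, hζr⟩ := exists_common_root_of_resultant_eq_zero (hWm.map (evalAt b))
      ((hWm.natDegree_map _).trans hWd) (p := fun i => (r i).map (evalAt b))
      (fun i => natDegree_map_le.trans (hrd i)) (Nat.lt_succ_self (d * N)) (fun j => by
        have h1 := hb4 j
        rw [hb3 j, ← evalAt_apply, ← resultant_map_map] at h1
        rw [← h1]
        congr 1
        simp [P, Polynomial.map_sum])
    have hζδ : ‖ζ‖ < δ := norm_lt_of_pow_eq_eval (degree_map_le.trans_lt hp) hδ0 (min_le_right _ _)
      hb1 (by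
        rw [hWb, eval_sub, eval_pow, eval_X] at hζ
        exact sub_eq_zero.1 hζ)
    let y : Cn (n + 1) := Fin.cons ζ b
    have hyb : tailL n y = b := rfl
    have hy : dist y 0 < δ₀ := by
      refine lt_of_lt_of_le ?_ (min_le_left δ₀ 1)
      rw [dist_zero_right, pi_norm_lt_iff hδ0]
      refine Fin.cases hζδ fun i => ?_
      exact (norm_le_pi_norm b i).trans_lt (mem_ball_zero_iff.1 hb2)
    obtain ⟨h1, h2, h3, h4⟩ := hball hy
    rw [hyb] at h2 h3
    have h5 : rep f y = 0 := by
      have h6 : rep q y * rep f y = 0 := h3.trans hζ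
      exact (mul_eq_zero.1 h6).resolve_left h4
    have h6 : y = 0 := h1 fun i => by
      rw [h2 i, h5, mul_zero, zero_add]
      exact hζr i
    rw [← hyb, h6, map_zero]
  have hrad := ih _ _ hzero
  have htail : ∀ φ ∈ IsLocalRing.maximalIdeal (GermRing n), pullL (tailL n) φ ∈ I.radical := by
    intro φ hφ
    obtain ⟨k, hk⟩ := hrad hφ
    refine ⟨k, ?_⟩
    have h1 : Ideal.span (range fun j => germ n (R j)) ≤
        I.comap (pullL (tailL n) : GermRing n →+* GermRing (n + 1)) := by
      rw [Ideal.span_le]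
      rintro _ ⟨j, rfl⟩
      exact hRI j
    rw [← map_pow]
    exact h1 hk
  rw [maximalIdeal_eq_span, Ideal.span_le]
  rintro _ ⟨i, rfl⟩
  refine Fin.cases ?_ (fun i => ?_) i
  · have h1 : GermRing.X 0 ^ d ∈ I.radical := by
      rw [hqp]
      refine I.radical.add_mem (I.radical.mul_mem_left _ (Ideal.le_radical (hGI i₀))) ?_
      rw [p.as_sum_range_C_mul_X_pow, map_sum]
      refine I.radical.sum_mem fun j _ => ?_
      rw [map_mul, polyGerm_C]
      refine I.radical.mul_mem_right _ (htail _ ?_)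
      have h2 := congrArg (fun s => s.coeff j) hp0
      rw [mem_maximalIdeal, germ_apply, value_mk]
      simpa [evalAt_apply] using h2
    obtain ⟨k, hk⟩ := h1
    exact ⟨d * k, by rwa [pow_mul]⟩
  · rw [← pullL_tailL_X]
    exact htail _ (X_mem_maximalIdeal i)

/-- The analytic Nullstellensatz for ideals with an isolated zero. -/
theorem maximalIdeal_le_radical {n N : ℕ} (G : Fin N → GermRing n)
    (hG : ∀ᶠ y in 𝓝 0, (∀ i, rep (G i) y = 0) → y = 0) :
    IsLocalRing.maximalIdeal (GermRing n) ≤ (Ideal.span (range G)).radical := by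
  induction n generalizing N with
  | zero =>
    rw [maximalIdeal_eq_span, range_eq_empty, Ideal.span_empty]
    exact bot_le
  | succ n ih =>
    by_cases hu : ∃ i, value (n + 1) (G i) ≠ 0
    · obtain ⟨i, hi⟩ := hu
      rw [Ideal.eq_top_of_isUnit_mem _ (Ideal.subset_span (mem_range_self i)) (isUnit_iff.2 hi),
        Ideal.radical_top]
      exact le_top
    push Not at hu
    obtain ⟨i₀, hi₀⟩ : ∃ i, G i ≠ 0 := by
      by_contra! hcon
      have h1 : ∀ᶠ y in 𝓝 (0 : Cn (n + 1)), y = 0 := by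
        filter_upwards [hG, eventually_all.2 fun i => eq_zero_iff.1 (hcon i)] with y h1 h2
        exact h1 h2
      have h2 := (tendsto_line (Pi.single 0 1 : Cn (n + 1))).eventually h1
      obtain ⟨t, ht, ht0⟩ := ((h2.filter_mono nhdsWithin_le_nhds).and
        (self_mem_nhdsWithin (a := (0 : ℂ)) (s := {0}ᶜ))).exists
      exact ht0 (by simpa using congrFun ht 0)
    obtain ⟨v, hv⟩ := exists_lineOrder_ne_top' hi₀
    have hv0 : v ≠ 0 := by
      rintro rfl
      refine hv (analyticOrderAt_eq_top.2 (Eventually.of_forall fun t => ?_))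
      rw [smul_zero, ← value_apply, hu]
    obtain ⟨T, hT⟩ := SeparatingDual.exists_continuousLinearEquiv_apply_eq (R := ℂ)
      (x := (Pi.single 0 1 : Cn (n + 1))) (y := v) (by simp) hv0
    have h1 := maximalIdeal_le_radical_of_axis (fun M H hH => ih H hH)
      (G := fun i => pullL (T : Cn (n + 1) →L[ℂ] Cn (n + 1)) (G i)) (i₀ := i₀) (by
        filter_upwards [(tendsto_clm_zero (T : Cn (n + 1) →L[ℂ] Cn (n + 1))).eventually hG,
          eventually_all.2 fun i => rep_pullL (T : Cn (n + 1) →L[ℂ] Cn (n + 1)) (G i)]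
          with y h1 h2 h3
        exact T.map_eq_zero_iff.1 (h1 fun i => (h2 i).symm.trans (h3 i)))
      (by rw [value_pullL, hu]) (by
        intro h0
        apply hv
        rw [pullL_pullL, eq_zero_iff] at h0
        rw [lineOrder, analyticOrderAt_eq_top]
        have h2 := (tendsto_line (Pi.single 0 1 : Cn (n + 1))).eventually
          (h0.and (rep_pullL ((T : Cn (n + 1) →L[ℂ] Cn (n + 1)) ∘L axis n) (G i₀)))
        filter_upwards [h2] with t ht
        have h3 : (T : Cn (n + 1) →L[ℂ] Cn (n + 1)) (axis n (t • Pi.single 0 1)) = t • v := by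
          have h4 : axis n (t • Pi.single 0 1) = t • Pi.single 0 1 := by
            ext i
            by_cases hi : i = 0 <;> simp [axis, zeroOn_apply, hi]
          rw [h4, map_smul]
          exact congrArg (t • ·) hT
        rw [← h3]
        exact ht.2.symm.trans ht.1)
    intro φ hφ
    have hTT : ∀ φ : GermRing (n + 1), pullL (T.symm : Cn (n + 1) →L[ℂ] Cn (n + 1))
        (pullL (T : Cn (n + 1) →L[ℂ] Cn (n + 1)) φ) = φ := by
      intro φ
      rw [pullL_pullL, eq_iff]
      filter_upwards [rep_pullL ((T : Cn (n + 1) →L[ℂ] Cn (n + 1)) ∘L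
        (T.symm : Cn (n + 1) →L[ℂ] Cn (n + 1))) φ] with y hy
      rw [hy]
      simp
    obtain ⟨k, hk⟩ := h1 (x := pullL (T : Cn (n + 1) →L[ℂ] Cn (n + 1)) φ)
      (by rwa [mem_maximalIdeal, value_pullL, ← mem_maximalIdeal])
    refine ⟨k, ?_⟩
    have h2 : Ideal.span (range fun i => pullL (T : Cn (n + 1) →L[ℂ] Cn (n + 1)) (G i)) ≤
        (Ideal.span (range G)).comap
          (pullL (T.symm : Cn (n + 1) →L[ℂ] Cn (n + 1)) : GermRing (n + 1) →+* GermRing (n + 1)) := by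
      rw [Ideal.span_le]
      rintro _ ⟨i, rfl⟩
      change pullL (T.symm : Cn (n + 1) →L[ℂ] Cn (n + 1))
        (pullL (T : Cn (n + 1) →L[ℂ] Cn (n + 1)) (G i)) ∈ Ideal.span (range G)
      rw [hTT]
      exact Ideal.subset_span ⟨i, rfl⟩
    have h3 := h2 hk
    rw [Ideal.mem_comap, map_pow] at h3
    change (pullL (T.symm : Cn (n + 1) →L[ℂ] Cn (n + 1))
      (pullL (T : Cn (n + 1) →L[ℂ] Cn (n + 1)) φ)) ^ k ∈ _ at h3
    rwa [hTT] at h3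

end GermRing

section Freeness

open CategoryTheory Abelian

universe u

variable {A B : Type u} [CommRing A] [CommRing B] [Algebra A B]

/-- The ideal generated by the first `j` members of a finite family. -/
def initialIdeal {n : ℕ} (y : Fin n → B) (j : ℕ) : Ideal B :=
  Ideal.span (y '' {i | (i : ℕ) < j})

/-- Each member of the family is a nonzerodivisor modulo the preceding ones. -/
def IsRegularFamily {n : ℕ} (y : Fin n → B) : Prop :=
  ∀ (j : Fin n) (b : B), y j * b ∈ initialIdeal y j → b ∈ initialIdeal y j

theorem initialIdeal_mono {n : ℕ} (y : Fin n → B) {j k : ℕ} (h : j ≤ k) :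
    initialIdeal y j ≤ initialIdeal y k :=
  Ideal.span_mono (image_mono fun _ hi => lt_of_lt_of_le hi h)

theorem mem_initialIdeal_succ {n : ℕ} (y : Fin n → B) (j : Fin n) {b : B}
    (h : b ∈ initialIdeal y (j + 1)) : ∃ c, b - y j * c ∈ initialIdeal y j := by
  have h1 : {i : Fin n | (i : ℕ) < j + 1} = insert j {i : Fin n | (i : ℕ) < j} := by
    ext i
    simp only [mem_ofPred_eq, mem_insert_iff, Fin.ext_iff]
    omega
  rw [initialIdeal, h1, image_insert_eq, Ideal.mem_span_insert] at h
  obtain ⟨a, z, hz, rfl⟩ := h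
  exact ⟨a, by rwa [mul_comm, add_sub_cancel_left]⟩

theorem subsingleton_ext_of_linearEquiv {M N : Type u} [AddCommGroup M] [Module A M]
    [AddCommGroup N] [Module A N] (e : M ≃ₗ[A] N) {Y : ModuleCat.{u} A} {i : ℕ}
    (h : Subsingleton (Ext (ModuleCat.of A M) Y i)) : Subsingleton (Ext (ModuleCat.of A N) Y i) := by
  refine subsingleton_of_forall_eq 0 fun x => ?_
  rw [← Ext.mk₀_id_comp x, ← e.toModuleIso.inv_hom_id, ← Ext.mk₀_comp_mk₀_assoc,
    h.elim ((Ext.mk₀ e.toModuleIso.hom).comp x (zero_add i)) 0, Ext.comp_zero]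

section Quotient

variable {M Q : Type u} [AddCommGroup M] [Module A M] [Module B M] [IsScalarTower A B M]
  [AddCommGroup Q] [Module A Q] {y : B} {g : M →ₗ[A] Q}

/-- The map `g` exhibits `Q` as the quotient of `M` by the nonzerodivisor `y`. -/
structure IsRegularQuotient (y : B) (g : M →ₗ[A] Q) : Prop where
  injective : ∀ x : M, y • x = 0 → x = 0
  surjective : Function.Surjective g
  exact : ∀ x, g x = 0 ↔ ∃ x' : M, y • x' = x

theorem IsRegularQuotient.exists_shortExact (h : IsRegularQuotient y g) :
    ∃ w : ModuleCat.ofHom (Algebra.lsmul A A M y) ≫ ModuleCat.ofHom g = 0,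
      (ShortComplex.mk _ (ModuleCat.ofHom g) w).ShortExact := by
  refine ⟨?_, ModuleCat.shortComplex_shortExact _ ?_ ?_ h.surjective⟩
  · ext x
    exact (h.exact _).2 ⟨x, rfl⟩
  · exact h.exact
  · exact (injective_iff_map_eq_zero (Algebra.lsmul A A M y)).2 h.injective

theorem IsRegularQuotient.subsingleton_ext_succ (h : IsRegularQuotient y g) {Y : ModuleCat.{u} A}
    {i : ℕ} (h1 : Subsingleton (Ext (ModuleCat.of A M) Y i))
    (h2 : Subsingleton (Ext (ModuleCat.of A M) Y (i + 1))) :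
    Subsingleton (Ext (ModuleCat.of A Q) Y (i + 1)) := by
  obtain ⟨w, hS⟩ := h.exists_shortExact
  refine subsingleton_of_forall_eq 0 fun x => ?_
  obtain ⟨x₁, hx₁⟩ := Ext.contravariant_sequence_exact₃ hS Y x (h2.elim _ _) (add_comm 1 i)
  rw [← hx₁, h1.elim x₁ 0]
  exact Ext.comp_zero _ _ _ _ _

/-- An endomorphism coming from an ideal that annihilates `Y` acts as zero on `Ext M Y`. -/
theorem mk₀_lsmul_comp_eq_zero {J : Ideal A} {Y : ModuleCat.{u} A} (hY : ∀ a ∈ J, ∀ x : Y, a • x = 0)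
    {b : B} (hb : b ∈ J.map (algebraMap A B)) {i : ℕ} (β : Ext (ModuleCat.of A M) Y i) :
    (Ext.mk₀ (ModuleCat.ofHom (Algebra.lsmul A A M b))).comp β (zero_add i) = 0 := by
  induction hb using Submodule.span_induction with
  | mem b hb =>
    obtain ⟨a, ha, rfl⟩ := hb
    have h1 : ModuleCat.ofHom (Algebra.lsmul A A M (algebraMap A B a)) =
        a • 𝟙 (ModuleCat.of A M) := by
      ext x
      exact algebraMap_smul B a x
    have h2 : a • 𝟙 Y = 0 := by
      ext x
      exact hY a ha x
    rw [h1, Ext.mk₀_smul, Ext.smul_comp, Ext.mk₀_id_comp, Ext.smul_eq_comp_mk₀, h2, Ext.mk₀_zero,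
      Ext.comp_zero]
  | zero =>
    have h1 : ModuleCat.ofHom (Algebra.lsmul A A M (0 : B)) = 0 := by
      ext x
      exact zero_smul B x
    rw [h1, Ext.mk₀_zero, Ext.zero_comp]
  | add b c _ _ hb hc =>
    have h1 : ModuleCat.ofHom (Algebra.lsmul A A M (b + c)) =
        ModuleCat.ofHom (Algebra.lsmul A A M b) + ModuleCat.ofHom (Algebra.lsmul A A M c) := by
      ext x
      exact add_smul b c x
    rw [h1, Ext.mk₀_add, Ext.add_comp, hb, hc, add_zero]
  | smul c b _ hb =>
    have h1 : ModuleCat.ofHom (Algebra.lsmul A A M (c • b)) =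
        ModuleCat.ofHom (Algebra.lsmul A A M c) ≫ ModuleCat.ofHom (Algebra.lsmul A A M b) := by
      ext x
      change (c * b) • x = b • c • x
      rw [smul_smul, mul_comm]
    rw [h1, ← Ext.mk₀_comp_mk₀_assoc, hb, Ext.comp_zero]

theorem IsRegularQuotient.subsingleton_ext (hy : IsRegularQuotient y g)
    {J : Ideal A} {Y : ModuleCat.{u} A} (hY : ∀ a ∈ J, ∀ x : Y, a • x = 0) {K : ℕ}
    (hK : y ^ K ∈ J.map (algebraMap A B)) {i : ℕ}
    (h : Subsingleton (Ext (ModuleCat.of A Q) Y (i + 1))) :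
    Subsingleton (Ext (ModuleCat.of A M) Y i) := by
  obtain ⟨w, hS⟩ := hy.exists_shortExact
  refine subsingleton_of_forall_eq 0 fun x => ?_
  have key : ∀ k : ℕ, ∃ x' : Ext (ModuleCat.of A M) Y i,
      (Ext.mk₀ (ModuleCat.ofHom (Algebra.lsmul A A M (y ^ k)))).comp x' (zero_add i) = x := by
    intro k
    induction k with
    | zero =>
      refine ⟨x, ?_⟩
      have h1 : ModuleCat.ofHom (Algebra.lsmul A A M (y ^ 0)) = 𝟙 _ := by
        ext x
        change (y ^ 0) • x = x
        rw [pow_zero, one_smul]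
      rw [h1, Ext.mk₀_id_comp]
    | succ k ih =>
      obtain ⟨x', hx'⟩ := ih
      obtain ⟨x'', hx''⟩ := Ext.contravariant_sequence_exact₁ hS Y x' (add_comm 1 i) (h.elim _ _)
      refine ⟨x'', ?_⟩
      have h1 : ModuleCat.ofHom (Algebra.lsmul A A M (y ^ (k + 1))) =
          ModuleCat.ofHom (Algebra.lsmul A A M (y ^ k)) ≫
          ModuleCat.ofHom (Algebra.lsmul A A M y) := by
        ext x
        change (y ^ (k + 1)) • x = y • y ^ k • x
        rw [smul_smul, pow_succ']
      rw [h1, ← Ext.mk₀_comp_mk₀_assoc, hx'', hx']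
  obtain ⟨x', hx'⟩ := key K
  rw [← hx', mk₀_lsmul_comp_eq_zero hY hK]

end Quotient

variable (A) in
/-- The projection between consecutive quotients. -/
def initialProj {n : ℕ} (y : Fin n → B) (j : ℕ) :
    (B ⧸ initialIdeal y j) →ₗ[A] (B ⧸ initialIdeal y (j + 1)) :=
  (Ideal.Quotient.factorₐ A (initialIdeal_mono y (Nat.le_succ j))).toLinearMap

variable (A) in
theorem isRegularQuotient_initialProj {n : ℕ} {y : Fin n → B} (hy : IsRegularFamily y)
    (j : Fin n) : IsRegularQuotient (y j) (initialProj A y j) := by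
  have hg : ∀ b : B, initialProj A y j (Ideal.Quotient.mk _ b) = Ideal.Quotient.mk _ b :=
    fun b => rfl
  refine ⟨?_, ?_, ?_⟩
  · intro x hx
    obtain ⟨b, rfl⟩ := Ideal.Quotient.mk_surjective x
    exact Ideal.Quotient.eq_zero_iff_mem.2 (hy j b (Ideal.Quotient.eq_zero_iff_mem.1 hx))
  · intro x
    obtain ⟨b, rfl⟩ := Ideal.Quotient.mk_surjective x
    exact ⟨_, hg b⟩
  · intro x
    obtain ⟨b, rfl⟩ := Ideal.Quotient.mk_surjective x
    rw [hg, Ideal.Quotient.eq_zero_iff_mem]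
    constructor
    · intro hb
      obtain ⟨c, hc⟩ := mem_initialIdeal_succ y j hb
      exact ⟨Ideal.Quotient.mk _ c, (Ideal.Quotient.eq.2 hc).symm⟩
    · rintro ⟨x', hx'⟩
      obtain ⟨c, rfl⟩ := Ideal.Quotient.mk_surjective x'
      have h1 : y j * c - b ∈ initialIdeal y j := Ideal.Quotient.eq.1 hx'
      rw [← sub_sub_cancel (y j * c) b]
      exact sub_mem (Ideal.mul_mem_right _ _ (Ideal.subset_span ⟨j, Nat.lt_succ_self _, rfl⟩))
        (initialIdeal_mono y (Nat.le_succ _) h1)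

theorem subsingleton_ext_quotient_zero {n : ℕ} (y : Fin n → A) (Y : ModuleCat.{u} A) (i : ℕ) :
    Subsingleton (Ext (ModuleCat.of A (A ⧸ initialIdeal y 0)) Y (i + 1)) := by
  have h1 : initialIdeal y 0 = ⊥ := by simp [initialIdeal]
  have : Module.Projective A (A ⧸ initialIdeal y 0) := by
    rw [h1]
    exact Module.Projective.of_equiv (Submodule.quotEquivOfEqBot (⊥ : Ideal A) rfl).symm
  have := ModuleCat.projective_of_module_projective (ModuleCat.of A (A ⧸ initialIdeal y 0))
  exact Ext.subsingleton_of_projective _ _ _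

theorem subsingleton_ext_quotient {n : ℕ} {z : Fin n → A} (hz : IsRegularFamily z)
    (Y : ModuleCat.{u} A) (j : ℕ) (hj : j ≤ n) (i : ℕ) (hi : j < i) :
    Subsingleton (Ext (ModuleCat.of A (A ⧸ initialIdeal z j)) Y i) := by
  induction j generalizing i with
  | zero =>
    obtain ⟨i, rfl⟩ := Nat.exists_eq_succ_of_ne_zero hi.ne'
    exact subsingleton_ext_quotient_zero z Y i
  | succ j ih =>
    obtain ⟨i, rfl⟩ := Nat.exists_eq_succ_of_ne_zero (Nat.ne_zero_of_lt hi)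
    exact (isRegularQuotient_initialProj A hz ⟨j, hj⟩).subsingleton_ext_succ (ih (by omega) _ (by omega))
      (ih (by omega) _ (by omega))

theorem subsingleton_ext_one {n : ℕ} {z : Fin n → A} (hz : IsRegularFamily z)
    {y : Fin n → B} (hy : IsRegularFamily y)
    (e : (A ⧸ initialIdeal z n) ≃ₗ[A] (B ⧸ initialIdeal y n)) {J : Ideal A} {Y : ModuleCat.{u} A}
    (hY : ∀ a ∈ J, ∀ x : Y, a • x = 0) {K : ℕ} (hK : ∀ j, y j ^ K ∈ J.map (algebraMap A B)) :
    Subsingleton (Ext (ModuleCat.of A B) Y 1) := by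
  have hn : ∀ i, n < i → Subsingleton (Ext (ModuleCat.of A (B ⧸ initialIdeal y n)) Y i) := by
    intro i hi
    exact subsingleton_ext_of_linearEquiv e (subsingleton_ext_quotient hz Y n le_rfl i hi)
  have key : ∀ k ≤ n, ∀ i, n - k < i →
      Subsingleton (Ext (ModuleCat.of A (B ⧸ initialIdeal y (n - k))) Y i) := by
    intro k
    induction k with
    | zero => exact fun _ => hn
    | succ k ih =>
      intro hk i hi
      have h1 := ih (by omega) (i + 1) (by omega)
      have h2 : n - k = n - (k + 1) + 1 := by omega
      rw [h2] at h1
      exact (isRegularQuotient_initialProj A hy ⟨n - (k + 1), by omega⟩).subsingleton_ext hY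
        (hK _) h1
  have h0 := key n le_rfl 1 (by simp)
  rw [Nat.sub_self] at h0
  have h1 : initialIdeal y 0 = ⊥ := by simp [initialIdeal]
  exact subsingleton_ext_of_linearEquiv
    ((Submodule.quotEquivOfEqBot (initialIdeal y 0) h1).restrictScalars A) h0

theorem exists_minimal_presentation [IsLocalRing A] (M : Type u) [AddCommGroup M] [Module A M]
    [Module.Finite A M] : ∃ (N : ℕ) (p : (Fin N → A) →ₗ[A] M), Function.Surjective p ∧
      ∀ x, p x = 0 → ∀ i, x i ∈ IsLocalRing.maximalIdeal A := by
  classical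
  have hex : ∃ (N : ℕ) (p : (Fin N → A) →ₗ[A] M), Function.Surjective p :=
    Module.Finite.exists_fin' A M
  obtain ⟨p, hp⟩ := Nat.find_spec hex
  refine ⟨Nat.find hex, p, hp, fun x hx i => ?_⟩
  by_contra hxi
  have hmin := fun k => Nat.find_min hex (m := k)
  generalize Nat.find hex = N at p i x hmin
  obtain _ | N := N
  · exact i.elim0
  have hsum : ∀ v : Fin (N + 1) → A, p v = ∑ k, v k • p (Pi.single k 1) := by
    intro v
    conv_lhs => rw [pi_eq_sum_univ' v, map_sum]
    refine Finset.sum_congr rfl fun k _ => ?_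
    rw [map_smul]
  let q : (Fin N → A) →ₗ[A] M := Fintype.linearCombination A fun j => p (Pi.single (i.succAbove j) 1)
  have hq : ∀ j, p (Pi.single (i.succAbove j) 1) ∈ LinearMap.range q := fun j =>
    ⟨Pi.single j 1, by simp [q, Fintype.linearCombination_apply_single]⟩
  have hi : p (Pi.single i 1) ∈ LinearMap.range q := by
    have h1 := hsum x
    rw [hx, Fin.sum_univ_succAbove _ i] at h1
    have h2 : x i • p (Pi.single i 1) ∈ LinearMap.range q := by
      rw [eq_neg_of_add_eq_zero_left h1.symm]
      exact neg_mem (sum_mem fun j _ => Submodule.smul_mem _ _ (hq j))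
    exact (Submodule.smul_mem_iff_of_isUnit _ (by simpa using hxi)).1 h2
  refine hmin N (Nat.lt_succ_self N) ⟨q, fun m => ?_⟩
  obtain ⟨v, rfl⟩ := hp m
  rw [← LinearMap.mem_range, hsum]
  refine sum_mem fun k _ => Submodule.smul_mem _ _ ?_
  by_cases hk : k = i
  · exact hk ▸ hi
  · obtain ⟨j, rfl⟩ := Fin.exists_succAbove_eq hk
    exact hq j

/-- A finite module over a separated local ring is free if `Ext¹` to the residue field
vanishes. -/
theorem free_of_subsingleton_ext_one [IsLocalRing A] {M : Type u} [AddCommGroup M] [Module A M]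
    [Module.Finite A M] (hsep : ∀ a : A, (∀ k, a ∈ IsLocalRing.maximalIdeal A ^ k) → a = 0)
    (h : Subsingleton (Ext (ModuleCat.of A M)
      (ModuleCat.of A (A ⧸ IsLocalRing.maximalIdeal A)) 1)) : Module.Free A M := by
  obtain ⟨N, p, hp, hker⟩ := exists_minimal_presentation (A := A) M
  set 𝔪 := IsLocalRing.maximalIdeal A
  have hhom : ∀ f : LinearMap.ker p →ₗ[A] A ⧸ 𝔪, f = 0 := by
    intro f
    have hS := LinearMap.shortExact_shortComplexKer hp
    obtain ⟨u, hu⟩ := Ext.contravariant_sequence_exact₁ hS (ModuleCat.of A (A ⧸ 𝔪))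
      (Ext.mk₀ (ModuleCat.ofHom f)) (add_zero 1) (h.elim _ _)
    obtain ⟨u, rfl⟩ := (Ext.mk₀_bijective _ _).2 u
    rw [Ext.mk₀_comp_mk₀] at hu
    have hu' := (Ext.mk₀_bijective _ _).1 hu
    ext x
    have h1 : u.hom (x : Fin N → A) = f x := congrArg (fun t => t.hom x) hu'
    rw [← h1, pi_eq_sum_univ' (x : Fin N → A), map_sum]
    refine Finset.sum_eq_zero fun i _ => ?_
    rw [map_smul]
    obtain ⟨b, hb⟩ := Ideal.Quotient.mk_surjective (u.hom (Pi.single i 1))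
    rw [← hb]
    change Ideal.Quotient.mk 𝔪 ((x : Fin N → A) i * b) = 0
    exact Ideal.Quotient.eq_zero_iff_mem.2 (Ideal.mul_mem_right _ _ (hker x x.2 i))
  have htop : ∀ x : LinearMap.ker p, x ∈ 𝔪 • (⊤ : Submodule A (LinearMap.ker p)) := by
    intro x
    let := Ideal.Quotient.field 𝔪
    rw [← Submodule.Quotient.mk_eq_zero, ← Module.forall_dual_apply_eq_zero_iff (A ⧸ 𝔪)]
    intro f
    exact LinearMap.congr_fun
      (hhom ((f.restrictScalars A).comp (𝔪 • (⊤ : Submodule A (LinearMap.ker p))).mkQ)) x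
  have hpow : ∀ k, ∀ x : LinearMap.ker p, ∀ i, (x : Fin N → A) i ∈ 𝔪 ^ k := by
    intro k
    induction k with
    | zero => simp
    | succ k ih =>
      intro x i
      refine Submodule.smul_induction_on (p := fun w : LinearMap.ker p => (w : Fin N → A) i ∈ 𝔪 ^ (k + 1)) (htop x)
        (fun a ha y _ => ?_) fun y z hy hz => add_mem hy hz
      rw [pow_succ']
      exact Ideal.mul_mem_mul ha (ih y i)
  have hinj : Function.Injective p := by
    rw [← LinearMap.ker_eq_bot, eq_bot_iff]
    intro x hx
    exact funext fun i => hsep _ fun k => hpow k ⟨x, hx⟩ i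
  exact Module.Free.of_equiv (LinearEquiv.ofBijective p ⟨hinj, hp⟩)

end Freeness

section Freeness

open IsLocalRing

universe u

variable {A B : Type u} [CommRing A] [CommRing B]

theorem initialIdeal_eq_span_range {n : ℕ} (y : Fin n → B) :
    initialIdeal y n = Ideal.span (range y) := by
  have h : {i : Fin n | (i : ℕ) < n} = univ := eq_univ_of_forall fun i => i.2
  rw [initialIdeal, h, image_univ]

/-- A finite local homomorphism of local rings is free if the maximal ideals are generated by
regular families of the same length, the residue fields agree and the source is separated. -/
theorem free_of_isRegularFamily [Algebra A B] [IsLocalRing A] [IsLocalRing B] [Module.Finite A B]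
    {n : ℕ} {z : Fin n → A} {y : Fin n → B} (hz : IsRegularFamily z) (hy : IsRegularFamily y)
    (hzm : maximalIdeal A = Ideal.span (range z)) (hym : maximalIdeal B = Ideal.span (range y))
    (hres : ∀ b : B, ∃ a : A, b - algebraMap A B a ∈ maximalIdeal B)
    (hloc : ∀ a : A, algebraMap A B a ∈ maximalIdeal B ↔ a ∈ maximalIdeal A)
    (hsep : ∀ a : A, (∀ k, a ∈ maximalIdeal A ^ k) → a = 0)
    {K : ℕ} (hK : ∀ j, y j ^ K ∈ (maximalIdeal A).map (algebraMap A B)) : Module.Free A B := by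
  refine free_of_subsingleton_ext_one hsep (subsingleton_ext_one hz hy ?_ ?_ hK)
  · let f : A →ₗ[A] B ⧸ initialIdeal y n :=
      ((initialIdeal y n).mkQ.restrictScalars A).comp (Algebra.linearMap A B)
    have hf : ∀ a, f a = Ideal.Quotient.mk _ (algebraMap A B a) := fun _ => rfl
    have hker : initialIdeal z n = LinearMap.ker f := by
      ext a
      rw [LinearMap.mem_ker, hf, Ideal.Quotient.eq_zero_iff_mem, initialIdeal_eq_span_range,
        initialIdeal_eq_span_range, ← hzm, ← hym, hloc]
    refine (Submodule.quotEquivOfEq _ _ hker).trans (f.quotKerEquivOfSurjective fun q => ?_)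
    obtain ⟨b, rfl⟩ := Ideal.Quotient.mk_surjective q
    obtain ⟨a, ha⟩ := hres b
    refine ⟨a, ?_⟩
    rw [hf, eq_comm, Ideal.Quotient.eq, initialIdeal_eq_span_range, ← hym]
    exact ha
  · intro a ha x
    obtain ⟨b, rfl⟩ := Ideal.Quotient.mk_surjective x
    exact Ideal.Quotient.eq_zero_iff_mem.2 (Ideal.mul_mem_right _ _ ha)

end Freeness

section Descent

open IsLocalRing

variable {k A B : Type*} [CommRing k] [CommRing A] [CommRing B] [Algebra k A] [Algebra k B]
  [Algebra A B] [IsScalarTower k A B]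

/-- The derivation of `A` obtained from a derivation of an `A`-algebra and a linear form. -/
def Derivation.descend (l : B →ₗ[A] A) (D : Derivation k B B) : Derivation k A A :=
  Derivation.mk' ((l.restrictScalars k).comp ((D : B →ₗ[k] B).comp
    (IsScalarTower.toAlgHom k A B).toLinearMap)) fun a b => by
      change l (D (algebraMap A B (a * b))) = a • l (D (algebraMap A B b)) +
        b • l (D (algebraMap A B a))
      rw [map_mul, Derivation.leibniz, map_add, smul_eq_mul, smul_eq_mul, ← Algebra.smul_def,
        ← Algebra.smul_def, l.map_smul, l.map_smul]

theorem Derivation.descend_apply (l : B →ₗ[A] A) (D : Derivation k B B) (a : A) :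
    D.descend l a = l (D (algebraMap A B a)) := rfl

variable (k A) in
/-- Ideals of `A` stable under the derivations descended from derivations of `B` killing `y`. -/
def IsDescentStable (y : B) (I : Ideal A) : Prop :=
  ∀ (l : B →ₗ[A] A) (D : Derivation k B B), D y = 0 → ∀ a ∈ I, D.descend l a ∈ I

theorem isDescentStable_span {y : B} {S : Set A}
    (h : ∀ (l : B →ₗ[A] A) (D : Derivation k B B), D y = 0 → ∀ a ∈ S,
      D.descend l a ∈ Ideal.span S) : IsDescentStable k A y (Ideal.span S) := by
  intro l D hD a ha
  induction ha using Submodule.span_induction with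
  | mem a ha => exact h l D hD a ha
  | zero => simp
  | add a b _ _ ha hb => rw [map_add]; exact add_mem ha hb
  | smul c a ha' ha =>
    rw [smul_eq_mul, Derivation.leibniz]
    exact add_mem (Ideal.mul_mem_left _ _ ha) (Ideal.mul_mem_right _ _ ha')

theorem isDescentStable_span_singleton {y u : B} (hu : IsUnit u) {a : A} {f : ℕ}
    (h : algebraMap A B a = u * y ^ f) : IsDescentStable k A y (Ideal.span {a}) := by
  refine isDescentStable_span fun l D hD b hb => ?_
  obtain rfl := hb
  obtain ⟨v, hv⟩ := hu.exists_left_inv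
  have h1 : D (algebraMap A B b) = b • (v * D u) := by
    rw [Algebra.smul_def, h, Derivation.leibniz, Derivation.leibniz_pow, hD]
    simp only [smul_eq_mul, smul_zero, zero_add, mul_zero]
    linear_combination (-y ^ f * D u) * hv
  rw [Derivation.descend_apply, h1, map_smul]
  exact Ideal.mul_mem_right _ _ (Ideal.mem_span_singleton_self b)

theorem IsDescentStable.map_stable [Module.Finite A B] [Module.Free A B] {y : B} {I : Ideal A}
    (hI : IsDescentStable k A y I) (D : Derivation k B B) (hD : D y = 0) :
    ∀ b ∈ I.map (algebraMap A B), D b ∈ I.map (algebraMap A B) := by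
  intro b hb
  induction hb using Submodule.span_induction with
  | mem b hb =>
    obtain ⟨a, ha, rfl⟩ := hb
    rw [← (Module.Free.chooseBasis A B).sum_repr (D (algebraMap A B a))]
    refine sum_mem fun i _ => ?_
    rw [Algebra.smul_def]
    exact Ideal.mul_mem_right _ _ (Ideal.mem_map_of_mem _
      (hI ((Module.Free.chooseBasis A B).coord i) D hD a ha))
  | zero => simp
  | add a b _ _ ha hb => rw [map_add]; exact add_mem ha hb
  | smul c a ha' ha =>
    rw [smul_eq_mul, Derivation.leibniz]
    exact add_mem (Ideal.mul_mem_left _ _ ha) (Ideal.mul_mem_right _ _ ha')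

theorem isDescentStable_sSup {y : B} {S : Set (Ideal A)} (h : ∀ I ∈ S, IsDescentStable k A y I) :
    IsDescentStable k A y (sSup S) := by
  intro l D hD a ha
  rw [sSup_eq_iSup'] at ha
  induction ha using Submodule.iSup_induction' with
  | mem I a ha => exact le_sSup I.2 (h _ I.2 l D hD a ha)
  | zero => simp
  | add a b _ _ ha hb => rw [map_add]; exact add_mem ha hb

theorem isDescentStable_jacobian {y : B} {r : A} (h : IsDescentStable k A y (Ideal.span {r})) :
    IsDescentStable k A y (Ideal.span (insert r (range fun d : Derivation k A A => d r))) := by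
  refine isDescentStable_span fun l D hD a ha => ?_
  set J := Ideal.span (insert r (range fun d : Derivation k A A => d r))
  have hr : r ∈ J := Ideal.subset_span (mem_insert _ _)
  have hd : ∀ d : Derivation k A A, d r ∈ J := fun d =>
    Ideal.subset_span (mem_insert_of_mem _ ⟨d, rfl⟩)
  obtain rfl | ⟨d, rfl⟩ := ha
  · exact hd _
  · obtain ⟨c, hc⟩ := Ideal.mem_span_singleton'.1 (h l D hD r (Ideal.mem_span_singleton_self r))
    have h1 : D.descend l (d r) = ⁅D.descend l, d⁆ r + (c * d r + r * d c) := by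
      rw [Derivation.commutator_apply, ← hc, Derivation.leibniz]
      simp
    change D.descend l (d r) ∈ J
    rw [h1]
    exact add_mem (hd _) (add_mem (Ideal.mul_mem_left _ _ (hd _)) (Ideal.mul_mem_right _ _ hr))

variable [IsLocalRing A] [IsLocalRing B] [IsDomain B] [IsLocalHom (algebraMap A B)]
  [Module.Finite A B] [Module.Free A B]

theorem exists_descend_generator {y : B} (hy0 : y ≠ 0) (hy : y ∈ maximalIdeal B)
    (hstab : ∀ I : Ideal B, (∀ D : Derivation k B B, D y = 0 → ∀ b ∈ I, D b ∈ I) →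
      ∀ N, y ^ N ∈ I → ∃ e, I = Ideal.span {y ^ e})
    {p : A} {u : B} {m : ℕ} (hm : 0 < m) (hu : IsUnit u) (h : algebraMap A B p = u * y ^ m) :
    ∃ (r : A) (w : B) (e : ℕ), 0 < e ∧ IsUnit w ∧ algebraMap A B r = w * y ^ e ∧
      ∀ I, IsDescentStable k A y I → I ≤ maximalIdeal A → I ≤ Ideal.span {r} := by
  set P : Ideal A := sSup {I | IsDescentStable k A y I ∧ I ≤ maximalIdeal A} with hP
  have hPs : IsDescentStable k A y P := isDescentStable_sSup fun I hI => hI.1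
  have hPm : P ≤ maximalIdeal A := sSup_le fun I hI => hI.2
  have hle : ∀ I, IsDescentStable k A y I → I ≤ maximalIdeal A → I ≤ P := fun I h1 h2 =>
    le_sSup ⟨h1, h2⟩
  have hcomap : (maximalIdeal B).comap (algebraMap A B) = maximalIdeal A :=
    Ideal.ext fun a => not_iff_not.2 (isUnit_map_iff (algebraMap A B) a)
  have hpm : p ∈ maximalIdeal A := by
    rw [← hcomap, Ideal.mem_comap, h]
    exact Ideal.mul_mem_left _ _ (Ideal.pow_mem_of_mem _ hy _ hm)
  have hpP : p ∈ P := hle _ (isDescentStable_span_singleton hu h)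
    ((Ideal.span_singleton_le_iff_mem _).2 hpm) (Ideal.mem_span_singleton_self p)
  obtain ⟨e, he⟩ := hstab (P.map (algebraMap A B)) (fun D hD => hPs.map_stable D hD) m
    ((Ideal.unit_mul_mem_iff_mem _ hu).1 (h ▸ Ideal.mem_map_of_mem _ hpP))
  have hdvd : ∀ a ∈ P, ∃ c, algebraMap A B a = c * y ^ e := fun a ha => by
    have h1 := Ideal.mem_map_of_mem (algebraMap A B) ha
    rw [he] at h1
    obtain ⟨c, hc⟩ := Ideal.mem_span_singleton'.1 h1
    exact ⟨c, hc.symm⟩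
  have hye : y ^ e ∈ P.map (algebraMap A B) := he ▸ Ideal.mem_span_singleton_self _
  have hex : ∃ r ∈ P, ∃ w, IsUnit w ∧ algebraMap A B r = w * y ^ e := by
    by_contra! hcon
    have h1 : P.map (algebraMap A B) ≤ maximalIdeal B * Ideal.span {y ^ e} := by
      refine Ideal.map_le_iff_le_comap.2 fun a ha => ?_
      obtain ⟨c, hc⟩ := hdvd a ha
      rw [Ideal.mem_comap, hc]
      exact Ideal.mul_mem_mul (fun hcu => hcon a ha c hcu hc) (Ideal.mem_span_singleton_self _)
    obtain ⟨c, hc, hc1⟩ := Ideal.mem_mul_span_singleton.1 (h1 hye)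
    have h2 : c = 1 := mul_right_cancel₀ (pow_ne_zero e hy0) (by rw [hc1, one_mul])
    exact hc (h2 ▸ isUnit_one)
  obtain ⟨r, hrP, w, hw, hr⟩ := hex
  refine ⟨r, w, e, Nat.pos_of_ne_zero ?_, hw, hr, fun I h1 h2 => (hle I h1 h2).trans ?_⟩
  · rintro rfl
    have h1 : y ^ 0 ∈ maximalIdeal B := (Ideal.map_mono hPm).trans (Ideal.map_le_iff_le_comap.2 hcomap.ge) hye
    rw [pow_zero] at h1
    exact h1 isUnit_one
  · have h1 : P.map (algebraMap A B) = (Ideal.span {r}).map (algebraMap A B) := by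
      rw [he, Ideal.map_span, image_singleton, hr, mul_comm,
        Ideal.span_singleton_mul_right_unit hw]
    have h2 := congrArg (Ideal.comap (algebraMap A B)) h1
    rw [Ideal.comap_map_eq_self_of_faithfullyFlat, Ideal.comap_map_eq_self_of_faithfullyFlat] at h2
    exact h2.le

/-- If the image of `p` in `B` is associated to a power of the parameter `y`, then `p` is
associated to a power of an element of `A` with a nonvanishing derivative. -/
theorem exists_eq_unit_mul_pow {y : B} (hy0 : y ≠ 0) (hy : y ∈ maximalIdeal B)
    (hstab : ∀ I : Ideal B, (∀ D : Derivation k B B, D y = 0 → ∀ b ∈ I, D b ∈ I) →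
      ∀ N, y ^ N ∈ I → ∃ e, I = Ideal.span {y ^ e})
    (hder : ∀ a : A, ¬ IsUnit a → (∀ d : Derivation k A A, a ∣ d a) → a = 0)
    {p : A} {u : B} {m : ℕ} (hm : 0 < m) (hu : IsUnit u) (h : algebraMap A B p = u * y ^ m) :
    ∃ (r v : A) (s : ℕ), 0 < s ∧ IsUnit v ∧ p = v * r ^ s ∧ ¬ IsUnit r ∧
      ∃ d : Derivation k A A, IsUnit (d r) := by
  have hcomap : (maximalIdeal B).comap (algebraMap A B) = maximalIdeal A :=
    Ideal.ext fun a => not_iff_not.2 (isUnit_map_iff (algebraMap A B) a)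
  obtain ⟨r, w, e, he, hw, hr, hmax⟩ := exists_descend_generator hy0 hy hstab hm hu h
  have hmem : ∀ {a : A} {c : B} {f : ℕ}, 0 < f → algebraMap A B a = c * y ^ f →
      a ∈ maximalIdeal A := by
    intro a c f hf ha
    rw [← hcomap, Ideal.mem_comap, ha]
    exact Ideal.mul_mem_left _ _ (Ideal.pow_mem_of_mem _ hy _ hf)
  have hrm : r ∈ maximalIdeal A := hmem he hr
  have hr0 : r ≠ 0 := by
    rintro rfl
    rw [map_zero] at hr
    exact mul_ne_zero hw.ne_zero (pow_ne_zero e hy0) hr.symm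
  have hpow : ∀ f : ℕ, ∀ (a : A) (c : B), IsUnit c → algebraMap A B a = c * y ^ f →
      ∃ (v : A) (s : ℕ), (0 < f → 0 < s) ∧ IsUnit v ∧ a = v * r ^ s := by
    intro f
    induction f using Nat.strong_induction_on with
    | _ f ih =>
    intro a c hc ha
    obtain rfl | hf := Nat.eq_zero_or_pos f
    · refine ⟨a, 0, fun h => h, isUnit_of_map_unit (algebraMap A B) a ?_, by simp⟩
      simpa [ha] using hc
    · obtain ⟨b, rfl⟩ := Ideal.mem_span_singleton'.1 (hmax _ (isDescentStable_span_singleton hc ha)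
        ((Ideal.span_singleton_le_iff_mem _).2 (hmem hf ha)) (Ideal.mem_span_singleton_self a))
      rw [map_mul, hr] at ha
      have hef : e ≤ f := by
        by_contra! hlt
        obtain ⟨j, rfl⟩ := Nat.exists_eq_add_of_lt hlt
        have h1 : c = algebraMap A B b * w * y ^ j * y :=
          mul_right_cancel₀ (pow_ne_zero f hy0) (by rw [← ha]; ring)
        exact (h1 ▸ Ideal.mul_mem_left _ _ hy : c ∈ maximalIdeal B) hc
      obtain ⟨j, rfl⟩ := Nat.exists_eq_add_of_le hef
      obtain ⟨w', hw'⟩ := hw.exists_left_inv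
      have h1 : algebraMap A B b = w' * c * y ^ j :=
        mul_right_cancel₀ (pow_ne_zero e hy0)
          (by linear_combination w' * ha - algebraMap A B b * y ^ e * hw')
      obtain ⟨v, s, -, hv, hb⟩ := ih j (by omega) b (w' * c)
        ((IsUnit.of_mul_eq_one w hw').mul hc) h1
      exact ⟨v, s + 1, fun _ => s.succ_pos, hv, by rw [hb, pow_succ, mul_assoc]⟩
  obtain ⟨v, s, hs, hv, hp⟩ := hpow m p u hu h
  refine ⟨r, v, s, hs hm, hv, hp, hrm, ?_⟩
  by_contra! hcon
  refine hr0 (hder r hrm fun d => Ideal.mem_span_singleton.1 (hmax _ (isDescentStable_jacobian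
    (isDescentStable_span_singleton hw hr)) ?_ (Ideal.subset_span (mem_insert_of_mem _ ⟨d, rfl⟩))))
  refine Ideal.span_le.2 ?_
  rintro a (rfl | ⟨d, rfl⟩)
  · exact hrm
  · exact hcon d

end Descent

open IsLocalRing in
theorem AlgHom.exists_eq_unit_mul_pow.{u} {k : Type*} {A B : Type u} [CommRing k] [CommRing A]
    [CommRing B] [Algebra k A] [Algebra k B] [IsLocalRing A] [IsLocalRing B] [IsDomain B]
    (φ : A →ₐ[k] B) (hfin : φ.toRingHom.Finite) {n : ℕ} {z : Fin n → A} {x : Fin n → B}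
    (hz : IsRegularFamily z) (hx : IsRegularFamily x)
    (hzm : maximalIdeal A = Ideal.span (range z)) (hxm : maximalIdeal B = Ideal.span (range x))
    (hres : ∀ b : B, ∃ a : A, b - φ a ∈ maximalIdeal B)
    (hloc : ∀ a : A, φ a ∈ maximalIdeal B ↔ a ∈ maximalIdeal A)
    (hsep : ∀ a : A, (∀ k, a ∈ maximalIdeal A ^ k) → a = 0)
    {K : ℕ} (hK : ∀ j, x j ^ K ∈ (maximalIdeal A).map φ)
    {y : B} (hy0 : y ≠ 0) (hy : y ∈ maximalIdeal B)
    (hstab : ∀ I : Ideal B, (∀ D : Derivation k B B, D y = 0 → ∀ b ∈ I, D b ∈ I) →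
      ∀ N, y ^ N ∈ I → ∃ e, I = Ideal.span {y ^ e})
    (hder : ∀ a : A, ¬ IsUnit a → (∀ d : Derivation k A A, a ∣ d a) → a = 0)
    {p : A} {u : B} {m : ℕ} (hm : 0 < m) (hu : IsUnit u) (h : φ p = u * y ^ m) :
    ∃ (r v : A) (s : ℕ), 0 < s ∧ IsUnit v ∧ p = v * r ^ s ∧ ¬ IsUnit r ∧
      ∃ d : Derivation k A A, IsUnit (d r) := by
  let := φ.toRingHom.toAlgebra
  have : IsScalarTower k A B := IsScalarTower.of_algebraMap_eq fun c => (φ.commutes c).symm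
  have : Module.Finite A B := hfin
  have : Module.Free A B := free_of_isRegularFamily hz hx hzm hxm hres hloc hsep hK
  have : IsLocalHom (algebraMap A B) := ⟨fun a ha => by
    by_contra hna
    exact (hloc a).2 hna ha⟩
  exact _root_.exists_eq_unit_mul_pow hy0 hy hstab hder hm hu h

namespace GermRing

variable {n : ℕ}

theorem isRegularFamily_X : IsRegularFamily (X : Fin n → GermRing n) := by
  intro j b hb
  have h : {i : Fin n | (i : ℕ) < j} = ((Finset.Iio j : Finset (Fin n)) : Set (Fin n)) := by
    ext i
    simp
  rw [initialIdeal, h] at hb ⊢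
  exact X_mul_mem_span_X (by simp) hb

theorem exists_eq_unit_mul_pow_of_pull {g : Cn n → Cn n} (hg : AnalyticAt ℂ g 0) (hg0 : g 0 = 0)
    (hfin : ∀ᶠ y in 𝓝 0, g y = 0 → y = 0) {p u : GermRing n} {i : Fin n} {m : ℕ} (hm : 0 < m)
    (hu : IsUnit u) (h : pull g hg hg0 p = u * X i ^ m) :
    ∃ (r v : GermRing n) (s : ℕ), 0 < s ∧ IsUnit v ∧ p = v * r ^ s ∧ ¬ IsUnit r ∧
      ∃ d : Derivation ℂ (GermRing n) (GermRing n), IsUnit (d r) := by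
  have hrad : IsLocalRing.maximalIdeal (GermRing n) ≤
      (Ideal.span (range fun i => pull g hg hg0 (X i))).radical := by
    refine maximalIdeal_le_radical _ ?_
    have h1 : ∀ᶠ y in 𝓝 0, ∀ i, rep (pull g hg hg0 (X i)) y = g y i := by
      rw [eventually_all]
      intro i
      filter_upwards [rep_pull hg hg0 (X i), (tendsto_zero hg hg0).eventually (rep_X i)]
        with y h1 h2
      rw [h1, h2]
    filter_upwards [h1, hfin] with y h1 h2 h3
    exact h2 (funext fun i => (h1 i).symm.trans (h3 i))
  obtain ⟨K, hK⟩ := Ideal.exists_pow_le_of_le_radical_of_fg hrad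
    (maximalIdeal_eq_span (n := n) ▸ (Submodule.fg_span (finite_range _)))
  have hloc : ∀ a : GermRing n, pull g hg hg0 a ∈ IsLocalRing.maximalIdeal (GermRing n) ↔
      a ∈ IsLocalRing.maximalIdeal (GermRing n) := fun a => by
    rw [mem_maximalIdeal, mem_maximalIdeal, value_pull]
  refine AlgHom.exists_eq_unit_mul_pow (pull g hg hg0) (finite_pull hg hg0 hK) isRegularFamily_X
    isRegularFamily_X maximalIdeal_eq_span maximalIdeal_eq_span (fun b => ?_) hloc
    (fun a => eq_zero_of_forall_mem_pow) (K := K) (fun j => ?_) (X_ne_zero i) (X_mem_maximalIdeal i)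
    (fun I hI N hN => exists_eq_span_X_pow hI hN) (fun a => eq_zero_of_dvd_derivations) hm hu h
  · refine ⟨algebraMap ℂ _ (value n b), ?_⟩
    rw [mem_maximalIdeal, AlgHom.commutes, map_sub, AlgHom.commutes]
    simp
  · refine Ideal.span_le.2 ?_ (hK (Ideal.pow_mem_pow (X_mem_maximalIdeal j) K))
    rintro _ ⟨i, rfl⟩
    exact Ideal.mem_map_of_mem _ (X_mem_maximalIdeal i)

end GermRing

/-- A submersive holomorphic function is a coordinate in suitable holomorphic coordinates. -/
theorem exists_straightening {n : ℕ} {φ : Cn n → ℂ} (hφ : AnalyticAt ℂ φ 0) (hφ0 : φ 0 = 0)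
    (hd : fderiv ℂ φ 0 ≠ 0) : ∃ (i : Fin n) (h : Cn n → Cn n), AnalyticAt ℂ h 0 ∧ h 0 = 0 ∧
      (∀ᶠ y in 𝓝 0, φ (h y) = y i) ∧ ∀ᶠ y in 𝓝 0, h y = 0 → y = 0 := by
  obtain ⟨i, hi⟩ : ∃ i, fderiv ℂ φ 0 (Pi.single i 1) ≠ 0 := by
    by_contra! hcon
    exact hd (ContinuousLinearMap.coe_injective ((Pi.basisFun ℂ (Fin n)).ext fun i => by
      simpa using hcon i))
  set e : Cn n := Pi.single i 1
  have hei : e i = 1 := by simp [e]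
  set F : Cn n → Cn n := fun x => x + (φ x - x i) • e with hF
  set L : Cn n →L[ℂ] Cn n := ContinuousLinearMap.id ℂ (Cn n) +
    (fderiv ℂ φ 0 - ContinuousLinearMap.proj i).smulRight e with hL
  have hLx : ∀ x, L x = x + (fderiv ℂ φ 0 x - x i) • e := fun x => rfl
  have hinj : Function.Injective (L : Cn n →ₗ[ℂ] Cn n) := by
    refine (injective_iff_map_eq_zero _).2 fun x hx => ?_
    change L x = 0 at hx
    rw [hLx] at hx
    have h1 : fderiv ℂ φ 0 x = 0 := by
      have := congrFun hx i
      simpa [hei] using this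
    rw [h1, zero_sub, neg_smul, add_neg_eq_zero] at hx
    rw [hx, map_smul, smul_eq_mul] at h1
    rw [hx, (mul_eq_zero.1 h1).resolve_right hi, zero_smul]
  let E : Cn n ≃L[ℂ] Cn n := (LinearEquiv.ofInjectiveEndo _ hinj).toContinuousLinearEquiv
  have hE : (E : Cn n →L[ℂ] Cn n) = L := by
    ext1 x
    rfl
  have hFa : AnalyticAt ℂ F 0 :=
    analyticAt_id.add ((hφ.sub (GermRing.analyticAt_coord i 0)).smul analyticAt_const)
  have hFd : fderiv ℂ F 0 = E := by
    rw [hE]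
    exact ((hasFDerivAt_id _).add
      ((hφ.differentiableAt.hasFDerivAt.sub (hasFDerivAt_apply i _)).smul_const e)).fderiv
  have hF0 : F 0 = 0 := by simp [hF, hφ0]
  have hs : HasStrictFDerivAt F (E : Cn n →L[ℂ] Cn n) 0 := hFd ▸ hFa.hasStrictFDerivAt
  set Φ := hs.toOpenPartialHomeomorph F
  have hΦ : ∀ x, Φ x = F x := fun x => rfl
  have h0s : (0 : Cn n) ∈ Φ.source := hs.mem_toOpenPartialHomeomorph_source
  have h0t : (0 : Cn n) ∈ Φ.target := hF0 ▸ hs.image_mem_toOpenPartialHomeomorph_target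
  have hsymm0 : Φ.symm 0 = 0 := by
    have := Φ.left_inv h0s
    rwa [hΦ, hF0] at this
  have hright : ∀ᶠ y in 𝓝 (0 : Cn n), F (Φ.symm y) = y := by
    filter_upwards [Φ.open_target.mem_nhds h0t] with y hy
    exact Φ.right_inv hy
  refine ⟨i, Φ.symm, ?_, hsymm0, ?_, ?_⟩
  · have := Φ.analyticAt_symm' h0s hFa hFd
    rwa [hΦ, hF0] at this
  · filter_upwards [hright] with y hy
    have := congrFun hy i
    simpa [hF, hei] using this
  · filter_upwards [hright] with y hy h0
    rw [← hy, h0, hF0]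

namespace GermRing

variable {n : ℕ}

/-- A holomorphic germ vanishing only on the hyperplane `y i = 0`, but not divisible by the
coordinate, is a unit. -/
theorem isUnit_of_ne_zero_off_hyperplane {v : GermRing n} {i : Fin n}
    (hv : v ∉ Ideal.span {(X i : GermRing n)}) (h : ∀ᶠ y in 𝓝 0, rep v y = 0 → y i = 0) :
    IsUnit v := by
  rw [isUnit_iff]
  intro hv0
  obtain ⟨w, hw⟩ := exists_lineOrder_ne_top (zeroOn {i}) fun hcon => hv (by
    have := (mem_span_X_iff {i} v).2 hcon
    simpa using this)
  set w' := zeroOn {i} w with hw'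
  have hwi : w' i = 0 := by simp [hw', zeroOn_apply]
  set e : Cn n := Pi.single i 1
  have hei : e i = 1 := by simp [e]
  obtain ⟨R, hR, hball⟩ := Metric.eventually_nhds_iff_ball.1
    (h.and (analyticAt_rep v).eventually_analyticAt)
  have hne : ∀ᶠ t : ℂ in 𝓝[≠] 0, rep v (t • w') ≠ 0 :=
    (analyticAt_line v w').eventually_eq_zero_or_eventually_ne_zero.resolve_left fun hcon =>
      hw (analyticOrderAt_eq_top.2 hcon)
  have hin : ∀ᶠ t : ℂ in 𝓝 0, t • w' ∈ Metric.ball (0 : Cn n) R :=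
    (tendsto_line w').eventually (Metric.ball_mem_nhds 0 hR)
  obtain ⟨r, hr, hrball⟩ := Metric.nhds_basis_closedBall.eventually_iff.1
    ((eventually_nhdsWithin_iff.1 hne).and hin)
  have hcont : Continuous fun q : ℂ × ℂ => q.2 • w' + q.1 • e := by fun_prop
  have hin' : ∀ᶠ ε : ℂ in 𝓝 0, ∀ t ∈ Metric.closedBall (0 : ℂ) r,
      t • w' + ε • e ∈ Metric.ball (0 : Cn n) R := by
    refine (isCompact_closedBall 0 r).eventually_forall_of_forall_eventually fun t ht => ?_
    refine hcont.continuousAt.eventually (Metric.isOpen_ball.mem_nhds ?_)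
    simpa using (hrball ht).2
  have hS : ∀ t ∈ Metric.sphere (0 : ℂ) r, 0 < ‖rep v (t • w')‖ := fun t ht =>
    norm_pos_iff.2 ((hrball (Metric.sphere_subset_closedBall ht)).1
      (Metric.ne_of_mem_sphere ht hr.ne'))
  have hrepc : ∀ t ∈ Metric.closedBall (0 : ℂ) r, ContinuousAt (rep v) (t • w') := fun t ht =>
    (hball _ (hrball ht).2).2.continuousAt
  obtain ⟨δ, hδ, hδS⟩ : ∃ δ > 0, ∀ t ∈ Metric.sphere (0 : ℂ) r, δ < ‖rep v (t • w')‖ := by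
    obtain ⟨t₀, ht₀, hmin⟩ := (isCompact_sphere (0 : ℂ) r).exists_isMinOn
      (NormedSpace.sphere_nonempty.2 hr.le)
      (f := fun t : ℂ => ‖rep v (t • w')‖) fun t ht =>
        ((hrepc t (Metric.sphere_subset_closedBall ht)).comp
          (f := fun t : ℂ => t • w') (by fun_prop)).norm.continuousWithinAt
    exact ⟨‖rep v (t₀ • w')‖ / 2, half_pos (hS t₀ ht₀), fun t ht =>
      (half_lt_self (hS t₀ ht₀)).trans_le (hmin ht)⟩
  have hlow : ∀ᶠ ε : ℂ in 𝓝 0, ∀ t ∈ Metric.sphere (0 : ℂ) r,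
      δ < ‖rep v (t • w' + ε • e)‖ := by
    refine (isCompact_sphere 0 r).eventually_forall_of_forall_eventually fun t ht => ?_
    have h1 : ContinuousAt (fun q : ℂ × ℂ => rep v (q.2 • w' + q.1 • e)) (0, t) :=
      ContinuousAt.comp (f := fun q : ℂ × ℂ => q.2 • w' + q.1 • e)
        (by rw [zero_smul, add_zero]; exact hrepc t (Metric.sphere_subset_closedBall ht))
        hcont.continuousAt
    refine h1.norm.eventually (lt_mem_nhds ?_)
    simpa using hδS t ht
  have hsmall : ∀ᶠ ε : ℂ in 𝓝 0, ‖rep v (ε • e)‖ < δ := by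
    have h1 : ContinuousAt (fun ε : ℂ => rep v (ε • e)) 0 := (analyticAt_line v e).continuousAt
    refine h1.norm.eventually (gt_mem_nhds ?_)
    change ‖rep v ((0 : ℂ) • e)‖ < δ
    rwa [zero_smul, ← value_apply, hv0, norm_zero]
  obtain ⟨ε, ⟨⟨h1, h2⟩, h3⟩, hε⟩ := (((hin'.and hlow).and hsmall).filter_mono
    nhdsWithin_le_nhds |>.and (self_mem_nhdsWithin : {(0 : ℂ)}ᶜ ∈ 𝓝[≠] 0)).exists
  have hnz : ∀ t ∈ Metric.closedBall (0 : ℂ) r, rep v (t • w' + ε • e) ≠ 0 := fun t ht hcon => by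
    have := (hball _ (h1 t ht)).1 hcon
    rw [Pi.add_apply, Pi.smul_apply, Pi.smul_apply, hwi, hei, smul_zero, zero_add, smul_eq_mul,
      mul_one] at this
    exact hε this
  have hdiff : DiffContOnCl ℂ (fun t : ℂ => (rep v (t • w' + ε • e))⁻¹) (Metric.ball 0 r) := by
    refine DifferentiableOn.diffContOnCl fun t ht => ?_
    rw [closure_ball _ hr.ne'] at ht
    have hd : DifferentiableAt ℂ (fun t : ℂ => rep v (t • w' + ε • e)) t :=
      (hball _ (h1 t ht)).2.differentiableAt.comp (f := fun t : ℂ => t • w' + ε • e) t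
        (by fun_prop)
    exact (hd.inv (hnz t ht)).differentiableWithinAt
  have hmax := Complex.norm_le_of_forall_mem_frontier_norm_le Metric.isBounded_ball hdiff
    (C := δ⁻¹) (fun t ht => by
      rw [frontier_ball _ hr.ne'] at ht
      rw [norm_inv]
      exact inv_anti₀ hδ (h2 t ht).le) (subset_closure (Metric.mem_ball_self hr))
  rw [norm_inv, zero_smul, zero_add] at hmax
  have h4 : 0 < ‖rep v (ε • e)‖ := by
    have := hnz 0 (Metric.mem_closedBall_self hr.le)
    rw [zero_smul, zero_add] at this
    exact norm_pos_iff.2 this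
  exact absurd ((inv_le_inv₀ h4 hδ).1 hmax) (not_le.2 h3)

/-- A holomorphic germ with zero set the hyperplane `y i = 0` is associated to a power of the
coordinate. -/
theorem eq_unit_mul_X_pow {q : GermRing n} {i : Fin n}
    (h : ∀ᶠ y in 𝓝 0, rep q y = 0 ↔ y i = 0) :
    ∃ (u : GermRing n) (m : ℕ), 0 < m ∧ IsUnit u ∧ q = u * X i ^ m := by
  have hq : q ≠ 0 := by
    rintro rfl
    refine X_ne_zero i (eq_zero_iff.2 ?_)
    filter_upwards [h, rep_zero, rep_X i] with y h1 h2 h3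
    rw [h3]
    exact h1.1 h2
  have hex : ∃ m, ¬ (X i : GermRing n) ^ m ∣ q := by
    by_contra! hcon
    exact hq (eq_zero_of_forall_mem_pow fun k =>
      Ideal.mem_of_dvd _ (hcon k) (Ideal.pow_mem_pow (X_mem_maximalIdeal i) k))
  classical
  obtain ⟨m, hm, hdvd⟩ : ∃ m, (X i : GermRing n) ^ m ∣ q ∧ ¬ (X i : GermRing n) ^ (m + 1) ∣ q := by
    have h1 : Nat.find hex ≠ 0 := fun h0 => Nat.find_spec hex (by rw [h0, pow_zero]; exact one_dvd q)
    obtain ⟨m, hm⟩ := Nat.exists_eq_succ_of_ne_zero h1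
    refine ⟨m, not_not.1 (Nat.find_min hex (hm ▸ Nat.lt_succ_self m)), ?_⟩
    rw [← Nat.succ_eq_add_one, ← hm]
    exact Nat.find_spec hex
  obtain ⟨v, rfl⟩ := hm
  have hv : IsUnit v := by
    refine isUnit_of_ne_zero_off_hyperplane (i := i) (fun hmem => hdvd ?_) ?_
    · rw [pow_succ]
      exact mul_dvd_mul_left _ (Ideal.mem_span_singleton.1 hmem)
    · filter_upwards [h, rep_mul (X i ^ m) v] with y h1 h2 h3
      exact h1.1 (by rw [h2, h3, mul_zero])
  refine ⟨v, m, Nat.pos_of_ne_zero ?_, hv, mul_comm _ _⟩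
  rintro rfl
  rw [pow_zero, one_mul] at h
  exact isUnit_iff.1 hv (h.self_of_nhds.2 rfl)

end GermRing

/-- **Theorem A.** Let `g : (ℂⁿ, 0) → (ℂⁿ, 0)` be (a representative of) a germ of a
finite holomorphic map (finite: `g⁻¹(0) ∩ U = {0}` for the small neighborhood `U`).
Let `X` be (a representative of) a germ of an analytic hypersurface through `0` that is
singular at `0`.  Then the germ of the hypersurface `g⁻¹(X)` is singular at `0`. -/
theorem preimage_singular_hypersurface_singular
    {n : ℕ} (g : Cn n → Cn n) (U W : Set (Cn n))
    (hUopen : IsOpen U) (hU0 : (0 : Cn n) ∈ U)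
    (hWopen : IsOpen W) (hW0 : (0 : Cn n) ∈ W)
    (hghol : AnalyticOnNhd ℂ g U) (hmaps : MapsTo g U W) (hg0 : g 0 = 0)
    (hfin : U ∩ g ⁻¹' {0} = {0})
    (X : Set (Cn n)) (hX : IsHypersurfaceIn W X) (hX0 : (0 : Cn n) ∈ X)
    (hXsing : ¬ SmoothPointAt X 0) :
    ¬ SmoothPointAt (U ∩ g ⁻¹' X) 0 := by
  rintro ⟨V, φ, hV, h0V, hφ, hdφ, hset⟩
  obtain ⟨V', hV', -, h0V', -, ψ, hψ, -, hset'⟩ := hX.2 0 hW0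
  have hφ0 : φ 0 = 0 := by
    have h1 : (0 : Cn n) ∈ (U ∩ g ⁻¹' X) ∩ V := ⟨⟨hU0, by rwa [mem_preimage, hg0]⟩, h0V⟩
    rw [hset] at h1
    exact h1.2
  obtain ⟨i, h, hh, hh0, hφh, hhfin⟩ := exists_straightening (hφ 0 h0V) hφ0 hdφ
  have hgh : AnalyticAt ℂ (fun y => g (h y)) 0 :=
    AnalyticAt.comp (g := g) (by rw [hh0]; exact hghol 0 hU0) hh
  have hgh0 : g (h 0) = 0 := by rw [hh0, hg0]
  have htend : Tendsto h (𝓝 0) (𝓝 0) := GermRing.tendsto_zero hh hh0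
  have hfin' : ∀ᶠ y in 𝓝 0, g (h y) = 0 → y = 0 := by
    filter_upwards [hhfin, htend.eventually (hUopen.mem_nhds hU0)] with y h1 h2 h3
    refine h1 ?_
    have h4 : h y ∈ U ∩ g ⁻¹' {0} := ⟨h2, h3⟩
    rwa [hfin] at h4
  set p : GermRing n := GermRing.mk ψ (hψ 0 h0V') with hp
  have hzero : ∀ᶠ y in 𝓝 0, GermRing.rep (GermRing.pull _ hgh hgh0 p) y = 0 ↔ y i = 0 := by
    have htend' : Tendsto (fun y => g (h y)) (𝓝 0) (𝓝 0) := GermRing.tendsto_zero hgh hgh0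
    filter_upwards [GermRing.rep_pull hgh hgh0 p, htend'.eventually (GermRing.rep_mk (hψ 0 h0V')), hφh,
      htend.eventually (hUopen.mem_nhds hU0), htend.eventually (hV.mem_nhds h0V),
      htend'.eventually (hV'.mem_nhds h0V')] with y h1 h2 h3 h4 h5 h6
    rw [h1, h2, ← h3]
    have e1 : g (h y) ∈ X ↔ ψ (g (h y)) = 0 :=
      ⟨fun hy => (hset'.le ⟨hy, h6⟩).2, fun hy => (hset'.ge ⟨h6, hy⟩).1⟩
    have e2 : g (h y) ∈ X ↔ φ (h y) = 0 :=
      ⟨fun hy => (hset.le ⟨⟨h4, hy⟩, h5⟩).2, fun hy => (hset.ge ⟨h5, hy⟩).1.2⟩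
    rw [← e1, ← e2]
  obtain ⟨u, m, hm, hu, hpu⟩ := GermRing.eq_unit_mul_X_pow hzero
  obtain ⟨r, v, s, hs, hv, hprv, hr, d, hd⟩ :=
    GermRing.exists_eq_unit_mul_pow_of_pull hgh hgh0 hfin' hm hu hpu
  refine hXsing ?_
  have hvne : ∀ᶠ y in 𝓝 0, GermRing.rep v y ≠ 0 :=
    (GermRing.analyticAt_rep v).continuousAt.eventually_ne (GermRing.isUnit_iff.1 hv)
  have hev : ∀ᶠ y in 𝓝 0, AnalyticAt ℂ (GermRing.rep r) y ∧ (y ∈ X ↔ GermRing.rep r y = 0) := by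
    filter_upwards [(GermRing.analyticAt_rep r).eventually_analyticAt, hvne, hV'.mem_nhds h0V',
      (GermRing.rep_mk (hψ 0 h0V')).symm.trans (hprv ▸ GermRing.rep_mul v (r ^ s)), GermRing.rep_pow r s]
      with y h1 h2 h3 h4 h5
    refine ⟨h1, ?_⟩
    have e1 : y ∈ X ↔ ψ y = 0 :=
      ⟨fun hy => (hset'.le ⟨hy, h3⟩).2, fun hy => (hset'.ge ⟨h3, hy⟩).1⟩
    rw [e1, h4, h5, mul_eq_zero, or_iff_right h2, pow_eq_zero_iff hs.ne']
  obtain ⟨T, hT, hTo, h0T⟩ := eventually_nhds_iff.1 hev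
  refine ⟨T, GermRing.rep r, hTo, h0T, fun y hy => (hT y hy).1, GermRing.fderiv_rep_ne_zero hr hd, ?_⟩
  ext y
  simp only [mem_inter_iff, mem_ofPred_eq]
  exact ⟨fun hy => ⟨hy.2, (hT y hy.2).2.1 hy.1⟩, fun hy => ⟨(hT y hy.1).2.2 hy.2, hy.1⟩⟩
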